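/- arXiv:1709.08892 — 10 statements merged into one kernel-verified Lean document; each statement's English description precedes it below -/
import Mathlib

section
/- Let a > 0 and b > 1, and define G(λ) = b(e^{−aλ} − 1) + aλ. Then G is strictly convex, G(0) = 0, G has exactly one further zero λ₊, this zero is positive, and it satisfies the lower bound λ₊ > (2/a) ln b. -/
/-- For `a > 0`, `b > 1`, the characteristic function
`G(λ) = b(e^{−aλ} − 1) + aλ` is strictly convex, vanishes at `0`, has exactly
one further zero `λ₊`, which is positive and satisfies `λ₊ > (2/a) ln b`. -/
theorem charfn_G_b_gt_one
    (a b : ℝ) (ha : 0 < a) (hb : 1 < b) :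
    StrictConvexOn ℝ Set.univ
      (fun lam : ℝ => b * (Real.exp (-(a * lam)) - 1) + a * lam) ∧
    (b * (Real.exp (-(a * (0:ℝ))) - 1) + a * 0 = 0) ∧
    ∃ lamp : ℝ, 0 < lamp ∧
      b * (Real.exp (-(a * lamp)) - 1) + a * lamp = 0 ∧
      2 / a * Real.log b < lamp ∧
      ∀ mu : ℝ, b * (Real.exp (-(a * mu)) - 1) + a * mu = 0 → mu = 0 ∨ mu = lamp := by
  have hconv : StrictConvexOn ℝ Set.univ
      (fun lam : ℝ => b * (Real.exp (-(a * lam)) - 1) + a * lam) := by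
    refine ⟨convex_univ, ?_⟩
    intro x _ y _ hxy s t hs ht hst
    have hne : -(a * x) ≠ -(a * y) := by
      intro h
      exact hxy (mul_left_cancel₀ ha.ne' (neg_injective h))
    have h := strictConvexOn_exp.2 (Set.mem_univ (-(a * x))) (Set.mem_univ (-(a * y))) hne hs ht hst
    simp only [smul_eq_mul] at h ⊢
    have e : -(a * (s * x + t * y)) = s * -(a * x) + t * -(a * y) := by ring
    rw [e]
    have h2 := mul_lt_mul_of_pos_left h (by linarith : 0 < b)
    have h3 : b = s * b + t * b := by rw [← add_mul, hst, one_mul]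
    nlinarith
  refine ⟨hconv, by simp, ?_⟩
  have hb0 : 0 < b := by linarith
  have hl : 0 < Real.log b := Real.log_pos hb
  have hs := Real.self_lt_sinh_iff.2 hl
  rw [Real.sinh_eq, Real.exp_neg, Real.exp_log hb0] at hs
  have hbi : 0 < b⁻¹ := inv_pos.2 hb0
  have hle : 2 / a * Real.log b < b / a := by
    rw [div_mul_eq_mul_div]
    apply div_lt_div_of_pos_right _ ha
    linarith
  have hpos : 0 < 2 / a * Real.log b := by positivity
  have hG1 : b * (Real.exp (-(a * (2 / a * Real.log b))) - 1) + a * (2 / a * Real.log b) < 0 := by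
    have e : a * (2 / a * Real.log b) = Real.log b + Real.log b := by field_simp; ring
    rw [e, Real.exp_neg, Real.exp_add, Real.exp_log hb0]
    have : b * ((b * b)⁻¹ - 1) = b⁻¹ - b := by field_simp
    rw [this]; linarith
  have hG2 : 0 < b * (Real.exp (-(a * (b / a))) - 1) + a * (b / a) := by
    have e : a * (b / a) = b := by field_simp
    rw [e]
    have := mul_pos hb0 (Real.exp_pos (-b))
    linarith
  have hc : ContinuousOn (fun lam : ℝ => b * (Real.exp (-(a * lam)) - 1) + a * lam)
      (Set.Icc (2 / a * Real.log b) (b / a)) := by fun_prop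
  obtain ⟨l, ⟨hl1, hl2⟩, hl0⟩ := intermediate_value_Ioo hle.le hc ⟨hG1, hG2⟩
  have key : ∀ x y z : ℝ, x < y → y < z →
      b * (Real.exp (-(a * x)) - 1) + a * x = 0 →
      b * (Real.exp (-(a * y)) - 1) + a * y = 0 →
      b * (Real.exp (-(a * z)) - 1) + a * z = 0 → False := by
    intro x y z hxy hyz h1 h2 h3
    have := hconv.slope_strict_mono_adjacent (Set.mem_univ x) (Set.mem_univ z) hxy hyz
    simp only [h1, h2, h3] at this
    simp at this
  have h00 : b * (Real.exp (-(a * (0:ℝ))) - 1) + a * 0 = 0 := by simp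
  have hlp : 0 < l := hpos.trans hl1
  refine ⟨l, hlp, hl0, hl1, ?_⟩
  intro mu hmu
  by_contra! hcon
  obtain ⟨hm0, hml⟩ := hcon
  rcases lt_or_gt_of_ne hm0 with h | h
  · exact key _ _ _ h hlp hmu h00 hl0
  · rcases lt_or_gt_of_ne hml with h' | h'
    · exact key _ _ _ h h' h00 hmu hl0
    · exact key _ _ _ hlp h' h00 hl0 hmu
end

section
/- Let â > 0 and 0 < b̂ < 1, and define H(λ) = b̂(e^{âλ} − 1) − âλ. Then H(0) = 0, H is strictly convex, H has a unique positive zero λ₋, and λ₋ satisfies the two-sided bound −(1/â) ln b̂ < λ₋ < −(2/â) ln b̂. -/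
/-- For `â > 0`, `0 < b̂ < 1`, the characteristic function
`H(λ) = b̂(e^{âλ} − 1) − âλ` vanishes at `0`, is strictly convex, has a unique
positive zero `λ₋`, and `λ₋` satisfies
`−(1/â) ln b̂ < λ₋ < −(2/â) ln b̂`. -/
theorem charfn_H_pos_zero
    (ahat bhat : ℝ) (ha : 0 < ahat) (hb0 : 0 < bhat) (hb1 : bhat < 1) :
    (bhat * (Real.exp (ahat * (0:ℝ)) - 1) - ahat * 0 = 0) ∧
    StrictConvexOn ℝ Set.univ
      (fun lam : ℝ => bhat * (Real.exp (ahat * lam) - 1) - ahat * lam) ∧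
    ∃ lamm : ℝ, (0 < lamm ∧
        bhat * (Real.exp (ahat * lamm) - 1) - ahat * lamm = 0) ∧
      (-(1 / ahat) * Real.log bhat < lamm ∧ lamm < -(2 / ahat) * Real.log bhat) ∧
      ∀ mu : ℝ, 0 < mu → bhat * (Real.exp (ahat * mu) - 1) - ahat * mu = 0 →
        mu = lamm := by
  have hconv : StrictConvexOn ℝ Set.univ
      (fun lam : ℝ => bhat * (Real.exp (ahat * lam) - 1) - ahat * lam) := by
    refine ⟨convex_univ, ?_⟩
    intro x _ y _ hxy s t hs ht hst
    have hne : ahat * x ≠ ahat * y := fun h => hxy (mul_left_cancel₀ ha.ne' h)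
    have h := strictConvexOn_exp.2 (Set.mem_univ (ahat * x)) (Set.mem_univ (ahat * y)) hne hs ht hst
    simp only [smul_eq_mul] at h ⊢
    have e : ahat * (s * x + t * y) = s * (ahat * x) + t * (ahat * y) := by ring
    rw [e]
    have h2 := mul_lt_mul_of_pos_left h hb0
    have e2 : bhat = (s + t) * bhat := by rw [hst, one_mul]
    linarith
  have key : ∀ x y : ℝ, 0 < x → x < y →
      bhat * (Real.exp (ahat * x) - 1) - ahat * x = 0 →
      bhat * (Real.exp (ahat * y) - 1) - ahat * y = 0 → False := by
    intro x y hx hxy h1 h2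
    have hy : 0 < y := hx.trans hxy
    have h := hconv.2 (Set.mem_univ (0:ℝ)) (Set.mem_univ y) hy.ne
      (show 0 < 1 - x / y by rw [sub_pos, div_lt_one hy]; exact hxy)
      (div_pos hx hy) (by ring)
    have e : x / y * y = x := div_mul_cancel₀ x hy.ne'
    simp only [smul_eq_mul, mul_zero, zero_add, e, h1, h2, Real.exp_zero, sub_self,
      add_zero, lt_irrefl] at h
  refine ⟨by simp, hconv, ?_⟩
  obtain ⟨L, hL⟩ : ∃ L, L = -Real.log bhat := ⟨_, rfl⟩
  have hLpos : 0 < L := by rw [hL]; linarith [Real.log_neg hb0 hb1]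
  have hbL : bhat = Real.exp (-L) := by rw [hL, neg_neg, Real.exp_log hb0]
  have e1 : ahat * (L / ahat) = L := by field_simp
  have e2 : ahat * (2 * L / ahat) = 2 * L := by field_simp
  have hA : bhat * (Real.exp (ahat * (L / ahat)) - 1) - ahat * (L / ahat) < 0 := by
    rw [e1, mul_sub, hbL, ← Real.exp_add, neg_add_cancel, Real.exp_zero]
    have := Real.add_one_lt_exp (x := -L) (by linarith)
    linarith
  have hB : 0 < bhat * (Real.exp (ahat * (2 * L / ahat)) - 1) - ahat * (2 * L / ahat) := by
    rw [e2, mul_sub, hbL, ← Real.exp_add, show -L + 2 * L = L by ring]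
    have := Real.self_lt_sinh_iff.2 hLpos
    rw [Real.sinh_eq] at this
    linarith
  have hle : L / ahat ≤ 2 * L / ahat := by gcongr; linarith
  have hcont : ContinuousOn (fun lam : ℝ => bhat * (Real.exp (ahat * lam) - 1) - ahat * lam)
      (Set.Icc (L / ahat) (2 * L / ahat)) := by fun_prop
  obtain ⟨z, ⟨hz1, hz2⟩, hz⟩ := intermediate_value_Ioo hle hcont ⟨hA, hB⟩
  have hz0 : 0 < z := (div_pos hLpos ha).trans hz1
  have hz' : bhat * (Real.exp (ahat * z) - 1) - ahat * z = 0 := hz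
  refine ⟨z, ⟨hz0, hz'⟩, ⟨?_, ?_⟩, ?_⟩
  · have : -(1 / ahat) * Real.log bhat = L / ahat := by rw [hL]; ring
    rwa [this]
  · have : -(2 / ahat) * Real.log bhat = 2 * L / ahat := by rw [hL]; ring
    rwa [this]
  · intro mu hmu h
    rcases lt_trichotomy mu z with hl | hl | hl
    · exact (key mu z hmu hl h hz').elim
    · exact hl
    · exact (key z mu hz0 hl hz' h).elim
end

section
/- Let ρ ↦ b(ρ) = −φ'(ρ)ρ/φ(ρ) = 1 − f'(ρ)ρ/f(ρ) and a(ρ) = ℓ/ρ, and for ρ ∈ (ρ*, 1) let λ₊(ρ) denote the unique positive zero of G(λ) = b(ρ)(e^{−a(ρ)λ} − 1) + a(ρ)λ. Then λ₊(ρ) > (2ρ/ℓ) ln(1 − f'(ρ)ρ/f(ρ)) for every ρ ∈ (ρ*, 1), and λ₊(ρ) → +∞ as ρ → 1⁻. -/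
/-- With `b(ρ) = −φ'(ρ)ρ/φ(ρ) = 1 − f'(ρ)ρ/f(ρ)` and
`a(ρ) = ℓ/ρ`, the unique positive zero `λ₊(ρ)` of
`G(λ) = b(ρ)(e^{−a(ρ)λ} − 1) + a(ρ)λ` satisfies
`λ₊(ρ) > (2ρ/ℓ) ln(1 − f'(ρ)ρ/f(ρ))` for every `ρ ∈ (ρ*, 1)`, and
`λ₊(ρ) → +∞` as `ρ → 1⁻`. -/
theorem lambda_plus_lower_bound_and_blowup
    (ℓ V c0 chat ρstar : ℝ) (hℓ : 0 < ℓ) (hV : 0 < V)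
    (hc0 : 0 < c0) (hchat : 0 < chat)
    (φ : ℝ → ℝ) (hφd : ContDiff ℝ 2 φ)
    (hφ1 : φ 1 = 0) (hφ0 : φ 0 = 1)
    (hφ' : ∀ ρ ∈ Set.Icc (0:ℝ) 1, deriv φ ρ ≤ -chat)
    (f : ℝ → ℝ) (hf : ∀ ρ, f ρ = V * ρ * φ ρ)
    (hf'' : ∀ ρ ∈ Set.Icc (0:ℝ) 1, deriv (deriv f) ρ ≤ -c0)
    (hρstar : ρstar ∈ Set.Ioo (0:ℝ) 1) (hρstarcrit : deriv f ρstar = 0)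
    (hρstaruniq : ∀ ρ ∈ Set.Ioo (0:ℝ) 1, deriv f ρ = 0 → ρ = ρstar)
    (lam : ℝ → ℝ)
    (hlam : ∀ ρ, ρstar < ρ → ρ < 1 →
      0 < lam ρ ∧
      (-(deriv φ ρ) * ρ / φ ρ) * (Real.exp (-(ℓ / ρ * lam ρ)) - 1)
        + (ℓ / ρ) * lam ρ = 0) :
    (∀ ρ, ρstar < ρ → ρ < 1 →
      2 * ρ / ℓ * Real.log (1 - deriv f ρ * ρ / f ρ) < lam ρ) ∧
    Filter.Tendsto lam (nhdsWithin 1 (Set.Iio 1)) Filter.atTop := by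
  have key : ∀ ρ, ρstar < ρ → ρ < 1 →
      0 < φ ρ ∧ 1 - deriv f ρ * ρ / f ρ = -(deriv φ ρ) * ρ / φ ρ ∧
      2 * ρ / ℓ * Real.log (-(deriv φ ρ) * ρ / φ ρ) < lam ρ := by
    intro ρ h1 h2
    obtain ⟨hl, he⟩ := hlam ρ h1 h2
    have hρ : 0 < ρ := hρstar.1.trans h1
    have hx : 0 < ℓ / ρ * lam ρ := by positivity
    have hlx : lam ρ = ρ / ℓ * (ℓ / ρ * lam ρ) := by field_simp
    have hd := hφ' ρ ⟨hρ.le, h2.le⟩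
    have hnum : 0 < -(deriv φ ρ) * ρ := mul_pos (by linarith) hρ
    generalize hxx : ℓ / ρ * lam ρ = x at *
    have hex : Real.exp (-x) < 1 := by rw [Real.exp_lt_one_iff]; linarith
    have hbpos : 0 < -(deriv φ ρ) * ρ / φ ρ := by
      by_contra hb
      push Not at hb
      nlinarith [mul_nonneg_of_nonpos_of_nonpos hb (by linarith : Real.exp (-x) - 1 ≤ 0)]
    have hφpos : 0 < φ ρ := by
      by_contra hb
      push Not at hb
      exact absurd hbpos (not_lt.2 (div_nonpos_of_nonneg_of_nonpos hnum.le hb))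
    have hφdiff : DifferentiableAt ℝ φ ρ := (hφd.differentiable (by norm_num)) ρ
    have hfd : deriv f ρ = V * φ ρ + V * ρ * deriv φ ρ := by
      have hff : f = fun ρ => V * ρ * φ ρ := funext hf
      rw [hff]
      have := (((hasDerivAt_id ρ).const_mul V).mul hφdiff.hasDerivAt).deriv
      simp only [id, mul_one] at this
      exact this
    refine ⟨hφpos, ?_, ?_⟩
    · rw [hfd, hf]
      field_simp
      ring
    · generalize -(deriv φ ρ) * ρ / φ ρ = b at *
      have hs : x / 2 < Real.sinh (x / 2) := Real.self_lt_sinh_iff.2 (by linarith)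
      rw [Real.sinh_eq] at hs
      have hm : Real.exp (x/2) * Real.exp (-(x/2)) = 1 := by
        rw [← Real.exp_add]; simp
      have hm2 : Real.exp (-x) = Real.exp (-(x/2)) * Real.exp (-(x/2)) := by
        rw [← Real.exp_add]; congr 1; ring
      have hE : x < Real.exp (x/2) * (1 - Real.exp (-x)) := by
        rw [hm2, mul_sub, ← mul_assoc, hm]; linarith
      have hb : b < Real.exp (x/2) := by
        have : b * (1 - Real.exp (-x)) < Real.exp (x/2) * (1 - Real.exp (-x)) := by linarith
        exact lt_of_mul_lt_mul_right this (by linarith)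
      have hlog : Real.log b < x / 2 := (Real.log_lt_iff_lt_exp hbpos).2 hb
      rw [hlx]
      have : 0 < ρ / ℓ := by positivity
      calc 2 * ρ / ℓ * Real.log b = ρ / ℓ * (2 * Real.log b) := by ring
        _ < ρ / ℓ * x := mul_lt_mul_of_pos_left (by linarith) this
  refine ⟨fun ρ h1 h2 => ?_, ?_⟩
  · obtain ⟨-, h, h'⟩ := key ρ h1 h2
    rwa [h]
  have hev : ∀ᶠ ρ in nhdsWithin (1:ℝ) (Set.Iio 1), ρstar < ρ ∧ ρ < 1 :=
    Ioo_mem_nhdsLT hρstar.2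
  have hφt : Filter.Tendsto φ (nhdsWithin 1 (Set.Iio 1)) (nhdsWithin 0 (Set.Ioi 0)) := by
    refine tendsto_nhdsWithin_iff.2 ⟨?_, hev.mono fun ρ h => (key ρ h.1 h.2).1⟩
    have := (hφd.continuous.tendsto 1).mono_left (nhdsWithin_le_nhds (s := Set.Iio 1))
    rwa [hφ1] at this
  have hb : Filter.Tendsto (fun ρ => Real.log (chat * ρstar * (φ ρ)⁻¹))
      (nhdsWithin 1 (Set.Iio 1)) Filter.atTop :=
    Real.tendsto_log_atTop.comp
      ((tendsto_inv_nhdsGT_zero.comp hφt).const_mul_atTop (mul_pos hchat hρstar.1))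
  have hc : Filter.Tendsto (fun ρ : ℝ => 2 * ρ / ℓ) (nhdsWithin 1 (Set.Iio 1))
      (nhds (2 * 1 / ℓ)) :=
    (Continuous.tendsto (by fun_prop) 1).mono_left nhdsWithin_le_nhds
  refine Filter.tendsto_atTop_mono' _ ?_ (hc.pos_mul_atTop (by positivity) hb)
  filter_upwards [hev] with ρ h
  obtain ⟨hp, -, h'⟩ := key ρ h.1 h.2
  have hρ : 0 < ρ := hρstar.1.trans h.1
  have hd := hφ' ρ ⟨hρ.le, h.2.le⟩
  refine le_trans ?_ h'.le
  have hs := hρstar.1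
  refine mul_le_mul_of_nonneg_left (Real.log_le_log (by positivity) ?_) (by positivity)
  rw [div_eq_mul_inv]
  exact mul_le_mul_of_nonneg_right
    (mul_le_mul (by linarith) h.1.le hs.le (by linarith)) (by positivity)
end

section
/- Let W : ℝ → (0,1) be a differentiable, monotone increasing solution of the delay differential equation W'(x) = (W(x)²/(ℓ φ(W(x)))) · [φ(W(x)) − φ(W(x + ℓ/W(x)))]. Then the function x ↦ ∫_x^{x + ℓ/W(x)} 1/(V φ(W(z))) dz is constant on ℝ. -/
/-- For a differentiable monotone increasing solution
`W : ℝ → (0,1)` of the profile DDE, the "period"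
`x ↦ ∫_x^{x+ℓ/W(x)} dz/(V φ(W(z)))` is constant in `x`. -/
theorem period_integral_constant
    (ℓ V chat : ℝ) (hℓ : 0 < ℓ) (hV : 0 < V) (hchat : 0 < chat)
    (φ : ℝ → ℝ) (hφd : Differentiable ℝ φ)
    (hφ1 : φ 1 = 0) (hφ0 : φ 0 = 1)
    (hφ' : ∀ ρ ∈ Set.Icc (0:ℝ) 1, deriv φ ρ ≤ -chat)
    (W : ℝ → ℝ) (hWmem : ∀ x, W x ∈ Set.Ioo (0:ℝ) 1)
    (hWmono : Monotone W) (hWd : Differentiable ℝ W)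
    (hdde : ∀ x, deriv W x =
      W x ^ 2 / (ℓ * φ (W x)) * (φ (W x) - φ (W (x + ℓ / W x)))) :
    ∀ x y : ℝ,
      (∫ z in x..(x + ℓ / W x), 1 / (V * φ (W z))) =
      ∫ z in y..(y + ℓ / W y), 1 / (V * φ (W z)) := by
  have hanti : StrictAntiOn φ (Set.Icc (0:ℝ) 1) := by
    apply strictAntiOn_of_deriv_neg (convex_Icc 0 1) hφd.continuous.continuousOn
    intro x hx
    have := hφ' x (interior_subset hx)
    linarith
  have hpos : ∀ x, 0 < φ (W x) := by
    intro x
    have h := hWmem x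
    have := hanti (Set.Ioo_subset_Icc_self h) (Set.right_mem_Icc.2 zero_le_one) h.2
    linarith
  have hg : Continuous (fun z => 1 / (V * φ (W z))) := by
    refine continuous_const.div
      (continuous_const.mul (hφd.continuous.comp hWd.continuous)) ?_
    intro x
    exact (mul_pos hV (hpos x)).ne'
  have hF : ∀ x, HasDerivAt (fun u => ∫ z in (0:ℝ)..u, 1 / (V * φ (W z)))
      (1 / (V * φ (W x))) x := fun x =>
    hg.integral_hasStrictDerivAt 0 x |>.hasDerivAt
  have hG : ∀ x, HasDerivAt (fun x => (∫ z in (0:ℝ)..(x + ℓ / W x), 1 / (V * φ (W z)))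
      - ∫ z in (0:ℝ)..x, 1 / (V * φ (W z))) 0 x := by
    intro x
    have hW0 : W x ≠ 0 := (hWmem x).1.ne'
    have h1 : HasDerivAt (fun x => x + ℓ / W x)
        (1 + (0 * W x - ℓ * deriv W x) / W x ^ 2) x :=
      (hasDerivAt_id x).add ((hasDerivAt_const x ℓ).div (hWd x).hasDerivAt hW0)
    have h2 := ((hF (x + ℓ / W x)).comp x h1).sub (hF x)
    refine h2.congr_deriv ?_
    rw [hdde x]
    have ha := (hpos x).ne'
    have hb := (hpos (x + ℓ / W x)).ne'
    generalize φ (W (x + ℓ / W x)) = b at *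
    generalize φ (W x) = a at *
    field_simp
    ring
  have hEq : ∀ x, (∫ z in x..(x + ℓ / W x), 1 / (V * φ (W z))) =
      (∫ z in (0:ℝ)..(x + ℓ / W x), 1 / (V * φ (W z)))
      - ∫ z in (0:ℝ)..x, 1 / (V * φ (W z)) := fun x =>
    (intervalIntegral.integral_interval_sub_left
      (hg.intervalIntegrable _ _) (hg.intervalIntegrable _ _)).symm
  intro x y
  rw [hEq x, hEq y]
  exact is_const_of_deriv_eq_zero (fun x => (hG x).differentiableAt) (fun x => (hG x).deriv) x y
end

section
/- Let W : ℝ → (0,1) be a differentiable, monotone increasing function such that x ↦ ∫_x^{x + ℓ/W(x)} 1/(V φ(W(z))) dz is constant on ℝ. Then W satisfies the identity (1 − ℓ W'(x)/W(x)²) · 1/φ(W(x + ℓ/W(x))) − 1/φ(W(x)) = 0 for all x, and consequently W solves the delay differential equation W'(x) = (W(x)²/(ℓ φ(W(x)))) · [φ(W(x)) − φ(W(x + ℓ/W(x)))]. -/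
/-- If for a differentiable monotone increasing `W : ℝ → (0,1)`
the quantity `∫_x^{x+ℓ/W(x)} dz/(V φ(W(z)))` is constant in `x`, then
`(1 − ℓW'(x)/W(x)²) / φ(W(x+ℓ/W(x))) − 1/φ(W(x)) = 0` for all `x`, and
consequently `W` solves the profile DDE. -/
theorem constant_period_implies_dde
    (ℓ V chat : ℝ) (hℓ : 0 < ℓ) (hV : 0 < V) (hchat : 0 < chat)
    (φ : ℝ → ℝ) (hφd : Differentiable ℝ φ)
    (hφ1 : φ 1 = 0) (hφ0 : φ 0 = 1)
    (hφ' : ∀ ρ ∈ Set.Icc (0:ℝ) 1, deriv φ ρ ≤ -chat)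
    (W : ℝ → ℝ) (hWmem : ∀ x, W x ∈ Set.Ioo (0:ℝ) 1)
    (hWmono : Monotone W) (hWd : Differentiable ℝ W)
    (hconst : ∀ x y : ℝ,
      (∫ z in x..(x + ℓ / W x), 1 / (V * φ (W z))) =
      ∫ z in y..(y + ℓ / W y), 1 / (V * φ (W z))) :
    (∀ x : ℝ,
      (1 - ℓ * deriv W x / W x ^ 2) * (1 / φ (W (x + ℓ / W x)))
        - 1 / φ (W x) = 0) ∧
    (∀ x : ℝ, deriv W x =
      W x ^ 2 / (ℓ * φ (W x)) * (φ (W x) - φ (W (x + ℓ / W x)))) := by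
  have hanti : StrictAntiOn φ (Set.Icc 0 1) := by
    apply strictAntiOn_of_deriv_neg (convex_Icc 0 1) hφd.continuous.continuousOn
    intro x hx
    have := hφ' x (interior_subset hx)
    linarith
  have hpos : ∀ x, 0 < φ (W x) := by
    intro x
    have h := hWmem x
    have := hanti ⟨h.1.le, h.2.le⟩ (Set.right_mem_Icc.2 zero_le_one) h.2
    linarith
  set g : ℝ → ℝ := fun z => 1 / (V * φ (W z)) with hg
  have hgc : Continuous g := by
    have h1 : Continuous fun z => V * φ (W z) :=
      continuous_const.mul (hφd.continuous.comp hWd.continuous)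
    exact continuous_const.div h1 (fun z => (mul_pos hV (hpos z)).ne')
  have hG : ∀ x, HasDerivAt (fun u => ∫ z in (0:ℝ)..u, g z) (g x) x := fun x =>
    intervalIntegral.integral_hasDerivAt_right (hgc.intervalIntegrable _ _)
      (hgc.stronglyMeasurableAtFilter _ _) hgc.continuousAt
  have key : ∀ x : ℝ,
      (1 - ℓ * deriv W x / W x ^ 2) * (1 / φ (W (x + ℓ / W x)))
        - 1 / φ (W x) = 0 := by
    intro x
    have hW0 : W x ≠ 0 := (hWmem x).1.ne'
    have h1 : HasDerivAt (fun y => y + ℓ / W y) (1 - ℓ * deriv W x / W x ^ 2) x := by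
      have := (hasDerivAt_id x).add ((hasDerivAt_const x ℓ).div (hWd x).hasDerivAt hW0)
      refine HasDerivAt.congr_deriv this ?_
      ring
    have h2 := ((hG (x + ℓ / W x)).comp x h1).sub (hG x)
    have h3 : HasDerivAt (fun _ : ℝ => ∫ z in (0:ℝ)..(0 + ℓ / W 0), g z) 0 x :=
      hasDerivAt_const _ _
    have h4 := h2.unique (h3.congr_of_eventuallyEq (Filter.Eventually.of_forall (fun y => by
      have := hconst y 0
      have e := intervalIntegral.integral_interval_sub_left
        (hgc.intervalIntegrable (μ := MeasureTheory.volume) 0 (y + ℓ / W y))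
        (hgc.intervalIntegrable 0 y)
      exact e.trans this)))
    simp only [hg] at h4
    have ha := (hpos x).ne'
    have hb := (hpos (x + ℓ / W x)).ne'
    have h5 : (1 - ℓ * deriv W x / W x ^ 2) * (1 / φ (W (x + ℓ / W x)))
        - 1 / φ (W x) = V * (1 / (V * φ (W (x + ℓ / W x))) * (1 - ℓ * deriv W x / W x ^ 2)
          - 1 / (V * φ (W x))) := by
      generalize φ (W (x + ℓ / W x)) = b at *
      field_simp
    rw [h5, h4, mul_zero]
  refine ⟨key, fun x => ?_⟩
  have hW0 : W x ≠ 0 := (hWmem x).1.ne'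
  have ha := (hpos x).ne'
  have hb := (hpos (x + ℓ / W x)).ne'
  have hk := key x
  generalize φ (W (x + ℓ / W x)) = b at *
  field_simp at hk ⊢
  linarith
end

section
/- Let W : ℝ → (0,1) be a differentiable monotone increasing solution of the DDE W'(x) = (W(x)²/(ℓ φ(W(x)))) · [φ(W(x)) − φ(W(x + ℓ/W(x)))] satisfying lim_{x→−∞} W(x) = ρ₋ and lim_{x→+∞} W(x) = ρ₊, where 0 < ρ₋ ≤ ρ* ≤ ρ₊ < 1 and f(ρ₋) = f(ρ₊) = f̄ > 0. Then the (constant) period t_p = ∫_x^{x+ℓ/W(x)} dz/(V φ(W(z))) equals ℓ/f̄ = ℓ/f(ρ₋) = ℓ/f(ρ₊). -/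
/-- For a differentiable monotone increasing solution of the
profile DDE with limits `ρ₋` at `−∞`, `ρ₊` at `+∞`, `0 < ρ₋ ≤ ρ* ≤ ρ₊ < 1`,
`f(ρ₋) = f(ρ₊) = f̄ > 0`, the constant period
`t_p = ∫_x^{x+ℓ/W(x)} dz/(V φ(W(z)))` equals `ℓ/f̄ = ℓ/f(ρ₋) = ℓ/f(ρ₊)`. -/
theorem period_equals_ell_over_flux
    (ℓ V c0 chat ρstar ρm ρp : ℝ)
    (hℓ : 0 < ℓ) (hV : 0 < V) (hc0 : 0 < c0) (hchat : 0 < chat)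
    (φ : ℝ → ℝ) (hφd : Differentiable ℝ φ)
    (hφ1 : φ 1 = 0) (hφ0 : φ 0 = 1)
    (hφ' : ∀ ρ ∈ Set.Icc (0:ℝ) 1, deriv φ ρ ≤ -chat)
    (f : ℝ → ℝ) (hf : ∀ ρ, f ρ = V * ρ * φ ρ)
    (hf'' : ∀ ρ ∈ Set.Icc (0:ℝ) 1, deriv (deriv f) ρ ≤ -c0)
    (hρstar : ρstar ∈ Set.Ioo (0:ℝ) 1) (hρstarcrit : deriv f ρstar = 0)
    (hρm0 : 0 < ρm) (hρms : ρm ≤ ρstar) (hρsp : ρstar ≤ ρp) (hρp1 : ρp < 1)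
    (hfeq : f ρm = f ρp) (hfpos : 0 < f ρm)
    (W : ℝ → ℝ) (hWmem : ∀ x, W x ∈ Set.Ioo (0:ℝ) 1)
    (hWmono : Monotone W) (hWd : Differentiable ℝ W)
    (hdde : ∀ x, deriv W x =
      W x ^ 2 / (ℓ * φ (W x)) * (φ (W x) - φ (W (x + ℓ / W x))))
    (hWlimm : Filter.Tendsto W Filter.atBot (nhds ρm))
    (hWlimp : Filter.Tendsto W Filter.atTop (nhds ρp)) :
    ∀ x : ℝ,
      (∫ z in x..(x + ℓ / W x), 1 / (V * φ (W z))) = ℓ / f ρm := by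
  have hanti : StrictAntiOn φ (Set.Icc (0:ℝ) 1) := by
    apply strictAntiOn_of_deriv_neg (convex_Icc 0 1) hφd.continuous.continuousOn
    intro x hx
    rw [interior_Icc] at hx
    have := hφ' x (Set.Ioo_subset_Icc_self hx)
    linarith
  have hφpos : ∀ ρ ∈ Set.Ioo (0:ℝ) 1, 0 < φ ρ := by
    intro ρ hρ
    have := hanti (Set.Ioo_subset_Icc_self hρ) (Set.right_mem_Icc.2 zero_le_one) hρ.2
    linarith
  have hW0 : ∀ x, 0 < W x := fun x => (hWmem x).1
  have hP : ∀ x, 0 < φ (W x) := fun x => hφpos _ (hWmem x)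
  have hφW : Antitone (fun x => φ (W x)) := fun a b hab =>
    hanti.antitoneOn (Set.Ioo_subset_Icc_self (hWmem a)) (Set.Ioo_subset_Icc_self (hWmem b))
      (hWmono hab)
  have hρp0 : 0 < ρp := by linarith
  have hPp : 0 < φ ρp := hφpos _ ⟨hρp0, hρp1⟩
  let g : ℝ → ℝ := fun z => 1 / (V * φ (W z))
  have hg : Continuous g := by
    have h1 : Continuous (fun z => V * φ (W z)) :=
      continuous_const.mul (hφd.continuous.comp hWd.continuous)
    exact continuous_const.div h1 (fun z => (mul_pos hV (hP z)).ne')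
  let T : ℝ → ℝ := fun x => ∫ z in x..(x + ℓ / W x), g z
  have hF : ∀ y, HasDerivAt (fun u => ∫ z in (0:ℝ)..u, g z) (g y) y := fun y =>
    intervalIntegral.integral_hasDerivAt_right (hg.intervalIntegrable _ _)
      hg.aestronglyMeasurable.stronglyMeasurableAtFilter hg.continuousAt
  have hTeq : T = fun x => (∫ z in (0:ℝ)..(x + ℓ / W x), g z) - ∫ z in (0:ℝ)..x, g z := by
    funext x
    exact (intervalIntegral.integral_interval_sub_left (hg.intervalIntegrable _ _)
      (hg.intervalIntegrable _ _)).symm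
  have hT' : ∀ x, HasDerivAt T 0 x := by
    intro x
    rw [hTeq]
    have h1 : HasDerivAt (fun x => x + ℓ / W x)
        (1 + (0 * W x - ℓ * deriv W x) / W x ^ 2) x :=
      (hasDerivAt_id x).add ((hasDerivAt_const x ℓ).div (hWd x).hasDerivAt (hW0 x).ne')
    have h2 := ((hF (x + ℓ / W x)).comp x h1).sub (hF x)
    refine h2.congr_deriv ?_
    rw [hdde x]
    have a1 := (hW0 x).ne'
    have a2 := (hP x).ne'
    have a3 := (hP (x + ℓ / W x)).ne'
    simp only [g]
    generalize φ (W (x + ℓ / W x)) = q at *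
    field_simp
    ring
  have hconst : ∀ x y, T x = T y :=
    is_const_of_deriv_eq_zero (fun x => (hT' x).differentiableAt) (fun x => (hT' x).deriv)
  have hlow : ∀ x, ℓ / W x * (1 / (V * φ (W x))) ≤ T x := by
    intro x
    have hle : x ≤ x + ℓ / W x := by have := div_pos hℓ (hW0 x); linarith
    have := intervalIntegral.integral_mono_on (μ := MeasureTheory.volume) hle
      ((continuous_const (y := g x)).intervalIntegrable _ _) (hg.intervalIntegrable _ _)
      (fun z hz => ?_)
    · rw [intervalIntegral.integral_const, add_sub_cancel_left, smul_eq_mul] at this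
      exact this
    · exact one_div_le_one_div_of_le (mul_pos hV (hP z))
        (mul_le_mul_of_nonneg_left (hφW hz.1) hV.le)
  have hup : ∀ x, T x ≤ ℓ / W x * (1 / (V * φ (W (x + ℓ / W x)))) := by
    intro x
    have hle : x ≤ x + ℓ / W x := by have := div_pos hℓ (hW0 x); linarith
    have := intervalIntegral.integral_mono_on (μ := MeasureTheory.volume) hle (hg.intervalIntegrable _ _)
      ((continuous_const (y := g (x + ℓ / W x))).intervalIntegrable _ _)
      (fun z hz => ?_)
    · rw [intervalIntegral.integral_const, add_sub_cancel_left, smul_eq_mul] at this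
      exact this
    · exact one_div_le_one_div_of_le (mul_pos hV (hP _))
        (mul_le_mul_of_nonneg_left (hφW hz.2) hV.le)
  have hshift : Filter.Tendsto (fun x => x + ℓ / W x) Filter.atTop Filter.atTop :=
    Filter.tendsto_atTop_mono (fun x => by have := div_pos hℓ (hW0 x); simp only [id]; linarith)
      Filter.tendsto_id
  have hφlim : Filter.Tendsto (fun x => φ (W x)) Filter.atTop (nhds (φ ρp)) :=
    (hφd.continuous.tendsto ρp).comp hWlimp
  have hlim : ∀ h : ℝ → ℝ, Filter.Tendsto h Filter.atTop (nhds (φ ρp)) →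
      Filter.Tendsto (fun x => ℓ / W x * (1 / (V * h x))) Filter.atTop
        (nhds (ℓ / ρp * (1 / (V * φ ρp)))) := fun h hh =>
    (tendsto_const_nhds.div hWlimp hρp0.ne').mul
      (tendsto_const_nhds.div (tendsto_const_nhds.mul hh) (mul_pos hV hPp).ne')
  intro x
  have hTl : Filter.Tendsto T Filter.atTop (nhds (ℓ / ρp * (1 / (V * φ ρp)))) :=
    tendsto_of_tendsto_of_tendsto_of_le_of_le (hlim _ hφlim) (hlim _ (hφlim.comp hshift))
      hlow hup
  have hTc : Filter.Tendsto T Filter.atTop (nhds (T x)) := by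
    have : T = fun _ => T x := funext fun y => hconst y x
    rw [this]
    exact tendsto_const_nhds
  have := tendsto_nhds_unique hTc hTl
  change T x = _
  rw [this, hfeq, hf]
  field_simp
end

section
/- Let W : ℝ → (0,1) be a differentiable monotone increasing solution of the DDE W'(x) = (W(x)²/(ℓ φ(W(x)))) · [φ(W(x)) − φ(W(x + ℓ/W(x)))] whose period t_p = ∫_x^{x+ℓ/W(x)} dz/(V φ(W(z))) (independent of x) equals ℓ/f̄ for some f̄ ∈ (0, f(ρ*)]. Then the limits L₋ = lim_{x→−∞} W(x) and L₊ = lim_{x→+∞} W(x) (which exist by monotonicity and boundedness) satisfy f(L₋) = f(L₊) = f̄. -/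
/-- If the constant period of a differentiable monotone
increasing solution of the profile DDE equals `ℓ/f̄` for some
`f̄ ∈ (0, f(ρ*)]`, then the limits `L₋ = lim_{x→−∞} W(x)` and
`L₊ = lim_{x→+∞} W(x)` satisfy `f(L₋) = f(L₊) = f̄`. -/
theorem period_determines_boundary_flux
    (ℓ V c0 chat ρstar fbar : ℝ)
    (hℓ : 0 < ℓ) (hV : 0 < V) (hc0 : 0 < c0) (hchat : 0 < chat)
    (φ : ℝ → ℝ) (hφd : Differentiable ℝ φ)
    (hφ1 : φ 1 = 0) (hφ0 : φ 0 = 1)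
    (hφ' : ∀ ρ ∈ Set.Icc (0:ℝ) 1, deriv φ ρ ≤ -chat)
    (f : ℝ → ℝ) (hf : ∀ ρ, f ρ = V * ρ * φ ρ)
    (hf'' : ∀ ρ ∈ Set.Icc (0:ℝ) 1, deriv (deriv f) ρ ≤ -c0)
    (hρstar : ρstar ∈ Set.Ioo (0:ℝ) 1) (hρstarcrit : deriv f ρstar = 0)
    (hfbar0 : 0 < fbar) (hfbarle : fbar ≤ f ρstar)
    (W : ℝ → ℝ) (hWmem : ∀ x, W x ∈ Set.Ioo (0:ℝ) 1)
    (hWmono : Monotone W) (hWd : Differentiable ℝ W)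
    (hdde : ∀ x, deriv W x =
      W x ^ 2 / (ℓ * φ (W x)) * (φ (W x) - φ (W (x + ℓ / W x))))
    (hperiod : ∀ x : ℝ,
      (∫ z in x..(x + ℓ / W x), 1 / (V * φ (W z))) = ℓ / fbar)
    (Lm Lp : ℝ)
    (hLm : Filter.Tendsto W Filter.atBot (nhds Lm))
    (hLp : Filter.Tendsto W Filter.atTop (nhds Lp)) :
    f Lm = fbar ∧ f Lp = fbar := by
  have hanti : StrictAntiOn φ (Set.Icc 0 1) := by
    apply strictAntiOn_of_deriv_neg (convex_Icc 0 1) hφd.continuous.continuousOn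
    intro x hx
    have := hφ' x (interior_subset hx)
    linarith
  have hpos : ∀ x, 0 < φ (W x) := by
    intro x
    have h := hanti (Set.Ioo_subset_Icc_self (hWmem x)) (Set.right_mem_Icc.2 zero_le_one) (hWmem x).2
    rwa [hφ1] at h
  have hle : ∀ x y, x ≤ y → φ (W y) ≤ φ (W x) := fun x y h =>
    hanti.antitoneOn (Set.Ioo_subset_Icc_self (hWmem x)) (Set.Ioo_subset_Icc_self (hWmem y))
      (hWmono h)
  have hcont : Continuous (fun z => 1 / (V * φ (W z))) := by
    apply Continuous.div continuous_const
    · exact continuous_const.mul (hφd.continuous.comp hWd.continuous)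
    · intro x
      exact (mul_pos hV (hpos x)).ne'
  have hWp : ∀ x, 0 < W x := fun x => (hWmem x).1
  have hstep : ∀ x, x ≤ x + ℓ / W x := fun x => by
    have := div_pos hℓ (hWp x)
    linarith
  have hlow : ∀ x, fbar ≤ V * W x * φ (W x) := by
    intro x
    have h1 : (∫ z in x..(x + ℓ / W x), 1 / (V * φ (W x))) ≤
        ∫ z in x..(x + ℓ / W x), 1 / (V * φ (W z)) := by
      apply intervalIntegral.integral_mono_on (hstep x) (by simp) (hcont.intervalIntegrable _ _)
      intro z hz
      apply one_div_le_one_div_of_le (mul_pos hV (hpos z))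
      exact mul_le_mul_of_nonneg_left (hle x z hz.1) hV.le
    rw [hperiod x, intervalIntegral.integral_const, smul_eq_mul, add_sub_cancel_left,
      div_mul_div_comm, mul_one, div_le_div_iff_of_pos_left hℓ
      (mul_pos (hWp x) (mul_pos hV (hpos x))) hfbar0] at h1
    linarith
  have hup : ∀ x, V * W x * φ (W (x + ℓ / W x)) ≤ fbar := by
    intro x
    have h1 : (∫ z in x..(x + ℓ / W x), 1 / (V * φ (W z))) ≤
        ∫ z in x..(x + ℓ / W x), 1 / (V * φ (W (x + ℓ / W x))) := by
      apply intervalIntegral.integral_mono_on (hstep x) (hcont.intervalIntegrable _ _) (by simp)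
      intro z hz
      apply one_div_le_one_div_of_le (mul_pos hV (hpos _))
      exact mul_le_mul_of_nonneg_left (hle z _ hz.2) hV.le
    rw [hperiod x, intervalIntegral.integral_const, smul_eq_mul, add_sub_cancel_left,
      div_mul_div_comm, mul_one, div_le_div_iff_of_pos_left hℓ hfbar0
      (mul_pos (hWp x) (mul_pos hV (hpos _)))] at h1
    linarith
  have key : ∀ (F : Filter ℝ) [F.NeBot] (L : ℝ), Filter.Tendsto W F (nhds L) →
      fbar ≤ f L := by
    intro F _ L hL
    rw [hf]
    exact ge_of_tendsto' ((hL.const_mul V).mul ((hφd.continuous.tendsto L).comp hL)) hlow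
  have key2 : ∀ (F : Filter ℝ) [F.NeBot] (L : ℝ), Filter.Tendsto W F (nhds L) →
      Filter.Tendsto (fun x => x + ℓ / W x) F F → f L ≤ fbar := by
    intro F _ L hL hs
    rw [hf]
    exact le_of_tendsto' ((hL.const_mul V).mul ((hφd.continuous.tendsto L).comp (hL.comp hs))) hup
  constructor
  · refine le_antisymm (key2 _ _ hLm ?_) (key _ _ hLm)
    have h0 : Lm ≠ 0 := by
      rintro rfl
      have := key _ _ hLm
      rw [hf] at this
      simp at this
      linarith
    exact Filter.Tendsto.atBot_add Filter.tendsto_id (Filter.Tendsto.div tendsto_const_nhds hLm h0)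
  · refine le_antisymm (key2 _ _ hLp ?_) (key _ _ hLp)
    exact Filter.tendsto_atTop_mono hstep Filter.tendsto_id
end

section
/- (Existence of discrete traveling wave profiles.) Given ℓ > 0, V > 0 and boundary states ρ₋, ρ₊ with 0 < ρ₋ < ρ* < ρ₊ < 1 and f(ρ₋) = f(ρ₊), there exists a differentiable, monotone increasing function W : ℝ → (0,1) which solves the delay differential equation W'(x) = (W(x)²/(ℓ φ(W(x)))) · [φ(W(x)) − φ(W(x + ℓ/W(x)))] for all x ∈ ℝ and satisfies the boundary conditions lim_{x→−∞} W(x) = ρ₋ and lim_{x→+∞} W(x) = ρ₊. -/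
open Set Filter Topology MeasureTheory

theorem tw_exists_lambda (a : ℝ) (ha : 1 < a) : ∃ l : ℝ, 0 < l ∧ a * (1 - Real.exp (-l)) = l := by
  let F : ℝ → ℝ := fun l => a * (1 - Real.exp (-l)) - l
  have hF : Continuous F := by fun_prop
  have h1 : F a ≤ 0 := by
    have := Real.exp_pos (-a)
    simp only [F]; nlinarith
  have hl : 0 < Real.log a := Real.log_pos ha
  have h2 : 0 ≤ F (Real.log a) := by
    simp only [F]
    rw [Real.exp_neg, Real.exp_log (by linarith)]
    have := Real.log_le_sub_one_of_pos (by linarith : (0:ℝ) < a)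
    have h3 : a * (1 - a⁻¹) = a - 1 := by field_simp
    linarith
  have hle : Real.log a ≤ a := by
    have := Real.log_le_sub_one_of_pos (by linarith : (0:ℝ) < a)
    linarith
  obtain ⟨l, hl1, hl2⟩ := intermediate_value_Icc' hle hF.continuousOn ⟨h1, h2⟩
  exact ⟨l, lt_of_lt_of_le hl hl1.1, by simp only [F] at hl2; linarith⟩

theorem tw_int_exp (l t : ℝ) (hl : 0 < l) :
    ∫ s in (0:ℝ)..1, Real.exp (-l * (t + s)) = Real.exp (-l * t) * ((1 - Real.exp (-l)) / l) := by
  have hd : ∀ s ∈ uIcc (0:ℝ) 1, HasDerivAt (fun s => -(1 / l) * Real.exp (-l * (t + s)))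
      (Real.exp (-l * (t + s))) s := by
    intro s _
    have h1 : HasDerivAt (fun s => -l * (t + s)) (-l * 1) s :=
      ((hasDerivAt_id s).const_add t).const_mul (-l)
    have h2 := (h1.exp).const_mul (-(1 / l))
    refine h2.congr_deriv ?_
    have : 1 / l * l = 1 := by field_simp
    linear_combination (Real.exp (-l * (t + s))) * this
  rw [intervalIntegral.integral_eq_sub_of_hasDerivAt hd
    (Continuous.intervalIntegrable (by fun_prop) _ _)]
  rw [mul_add, Real.exp_add]
  simp only [add_zero, mul_one]
  field_simp
  ring

theorem tw_fixed (G : ℝ → ℝ) (D a C : ℝ) (hD : 0 < D) (ha : 1 < a) (hC : 0 ≤ C)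
    (hGm : Monotone G) (hGc : Continuous G) (hG0 : G 0 = 0) (hGD : G D = D)
    (hGgt : ∀ v, 0 < v → v < D → v < G v)
    (hGu : ∀ v, 0 ≤ v → v ≤ D → G v ≤ a * v)
    (hGl : ∀ v, 0 ≤ v → v ≤ D → a * v - C * v ^ 2 ≤ G v) :
    ∃ u : ℝ → ℝ, Antitone u ∧ (∀ t, 0 ≤ u t ∧ u t ≤ D) ∧
      (∀ t, u t = ∫ s in (0:ℝ)..1, G (u (t + s))) ∧
      Tendsto u atBot (𝓝 D) ∧ Tendsto u atTop (𝓝 0) := by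
  obtain ⟨l, hl, hla⟩ := tw_exists_lambda a ha
  set E : ℝ → ℝ := fun t => Real.exp (-l * t) with hE
  have hEpos : ∀ t, 0 < E t := fun t => Real.exp_pos _
  have hEc : Continuous E := by fun_prop
  set q := Real.exp (-l) with hq
  have hq0 : 0 < q := Real.exp_pos _
  have hq1 : q < 1 := by
    rw [hq, ← Real.exp_zero]; exact Real.exp_lt_exp.mpr (by linarith)
  have hI1 : ∀ t, ∫ s in (0:ℝ)..1, E (t + s) = E t / a := by
    intro t
    have := tw_int_exp l t hl
    simp only [hE]
    rw [this, ← hq]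
    have : (1 - q) / l = 1 / a := by
      rw [div_eq_div_iff hl.ne' (by linarith)]; linarith
    rw [this]; ring
  set m := (1 + q) / 2 with hm
  have hm1 : m < 1 := by rw [hm]; linarith
  have hm0 : 0 < m := by positivity
  have hI2 : ∀ t, ∫ s in (0:ℝ)..1, E (t + s) ^ 2 = E t ^ 2 * (m / a) := by
    intro t
    have := tw_int_exp (2 * l) t (by linarith)
    have e : ∀ x, Real.exp (-(2 * l) * x) = E x ^ 2 := by
      intro x; simp only [hE]; rw [← Real.exp_nat_mul]; congr 1; push_cast; ring
    have e2 : Real.exp (-(2 * l)) = q ^ 2 := by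
      rw [hq, ← Real.exp_nat_mul]; congr 1; push_cast; ring
    simp only [e, e2] at this
    rw [this]
    congr 1
    rw [div_eq_div_iff (by linarith) (by linarith), hm, ← hla]
    ring
  -- choice of K
  obtain ⟨K, hK0, hKD, hKC⟩ : ∃ K : ℝ, 0 < K ∧ 1 ≤ K * D ∧ (a * K + C) * (m / a) ≤ K := by
    refine ⟨1 / D + C / (1 - m), ?_, ?_, ?_⟩
    · have : 0 < 1 - m := by linarith
      positivity
    · have : 0 < 1 - m := by linarith
      have h : 1 / D * D = 1 := by field_simp
      have : 0 ≤ C / (1 - m) * D := by positivity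
      nlinarith
    · have h1 : 0 < 1 - m := by linarith
      have ha0 : 0 < a := by linarith
      set K := 1 / D + C / (1 - m) with hK
      have h2 : C ≤ K * (1 - m) := by
        rw [hK, add_mul, div_mul_cancel₀ _ h1.ne']
        have : 0 ≤ 1 / D * (1 - m) := by positivity
        linarith
      have h3 : (a * K + C) * (m / a) = K * m + C * (m / a) := by field_simp
      have h4 : m / a ≤ 1 := by rw [div_le_one ha0]; linarith
      have h5 : C * (m / a) ≤ C := mul_le_of_le_one_right hC h4
      rw [h3]; nlinarith
  set sub : ℝ → ℝ := fun t => max 0 (E t - K * E t ^ 2) with hsub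
  set sup : ℝ → ℝ := fun t => min D (E t) with hsup
  have hsubc : Continuous sub := by fun_prop
  have hsub0 : ∀ t, 0 ≤ sub t := fun t => le_max_left _ _
  have hEanti : Antitone E := by
    intro x y hxy
    exact Real.exp_le_exp.mpr (by nlinarith)
  have hsupanti : Antitone sup := fun x y hxy => min_le_min le_rfl (hEanti hxy)
  have hsubsup : ∀ t, sub t ≤ sup t := by
    intro t
    have := hEpos t
    refine max_le (le_min hD.le this.le) (le_min ?_ ?_)
    · by_contra! h
      have : D < E t := by nlinarith [sq_nonneg (E t)]
      have : 1 ≤ K * E t := by nlinarith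
      nlinarith
    · nlinarith [sq_nonneg (E t)]
  let Q : (ℝ → ℝ) → ℝ → ℝ := fun w t => ∫ s in (0:ℝ)..1, G (w (t + s))
  have hint : ∀ w : ℝ → ℝ, Antitone w → ∀ t, IntervalIntegrable (fun s => G (w (t + s))) volume 0 1 := by
    intro w hw t
    apply Antitone.intervalIntegrable
    intro x y hxy
    exact hGm (hw (by linarith))
  have hQmono : ∀ w w' : ℝ → ℝ, Antitone w → Antitone w' → (∀ t, w t ≤ w' t) → ∀ t, Q w t ≤ Q w' t := by
    intro w w' hw hw' h t
    exact intervalIntegral.integral_mono_on zero_le_one (hint w hw t) (hint w' hw' t)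
      (fun s _ => hGm (h _))
  have hQanti : ∀ w : ℝ → ℝ, Antitone w → Antitone (Q w) := by
    intro w hw x y hxy
    exact intervalIntegral.integral_mono_on zero_le_one (hint w hw y) (hint w hw x)
      (fun s _ => hGm (hw (by linarith)))
  have hQsub : ∀ w : ℝ → ℝ, Antitone w → (∀ t, sub t ≤ w t) → ∀ t, sub t ≤ Q w t := by
    intro w hw h t
    refine max_le ?_ ?_
    · apply intervalIntegral.integral_nonneg zero_le_one
      intro s _
      rw [← hG0]
      exact hGm ((hsub0 _).trans (h _))
    · have key : ∀ s, a * E (t + s) - (a * K + C) * E (t + s) ^ 2 ≤ G (w (t + s)) := by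
        intro s
        refine le_trans ?_ (hGm (h (t + s)))
        set X := E (t + s) with hX
        have hXp : 0 < X := hEpos _
        rcases le_total (X - K * X ^ 2) 0 with hn | hp
        · have : sub (t + s) = 0 := max_eq_left hn
          rw [this, hG0]
          nlinarith [mul_nonneg hC (sq_nonneg X)]
        · have he : sub (t + s) = X - K * X ^ 2 := max_eq_right hp
          have hd : sub (t + s) ≤ D := (hsubsup _).trans (min_le_left _ _)
          rw [he] at hd ⊢
          refine le_trans ?_ (hGl _ hp hd)
          have : (X - K * X ^ 2) ^ 2 ≤ X ^ 2 := by
            apply pow_le_pow_left₀ hp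
            nlinarith [sq_nonneg X]
          nlinarith
      have hi1 : IntervalIntegrable (fun s => a * E (t + s)) volume 0 1 :=
        Continuous.intervalIntegrable (by fun_prop) _ _
      have hi2 : IntervalIntegrable (fun s => (a * K + C) * E (t + s) ^ 2) volume 0 1 :=
        Continuous.intervalIntegrable (by fun_prop) _ _
      have h1 := intervalIntegral.integral_mono_on zero_le_one (hi1.sub hi2) (hint w hw t)
        (fun s _ => key s)
      rw [intervalIntegral.integral_sub hi1 hi2, intervalIntegral.integral_const_mul,
        intervalIntegral.integral_const_mul, hI1, hI2] at h1
      refine le_trans ?_ h1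
      have : a * (E t / a) = E t := by field_simp
      rw [this]
      nlinarith [sq_nonneg (E t)]
  have hQsup : ∀ t, Q sup t ≤ sup t := by
    intro t
    refine le_min ?_ ?_
    · have h1 := intervalIntegral.integral_mono_on zero_le_one (hint sup hsupanti t)
        (intervalIntegrable_const (c := D)) (fun s _ => (hGm (min_le_left _ _)).trans_eq hGD)
      simpa using h1
    · have hi1 : IntervalIntegrable (fun s => a * E (t + s)) volume 0 1 :=
        Continuous.intervalIntegrable (by fun_prop) _ _
      have h1 := intervalIntegral.integral_mono_on zero_le_one (hint sup hsupanti t)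
        hi1 (fun s _ => by
          refine (hGu _ ((hsub0 _).trans (hsubsup _)) (min_le_left _ _)).trans ?_
          exact mul_le_mul_of_nonneg_left (min_le_right _ _) (by linarith))
      rw [intervalIntegral.integral_const_mul, hI1] at h1
      have : a * (E t / a) = E t := by field_simp
      rw [this] at h1
      exact h1
  let S : Set (ℝ → ℝ) := {w | Antitone w ∧ (∀ t, sub t ≤ w t) ∧ (∀ t, w t ≤ sup t) ∧ ∀ t, Q w t ≤ w t}
  have hsupS : sup ∈ S := ⟨hsupanti, hsubsup, fun _ => le_rfl, hQsup⟩
  have : Nonempty S := ⟨⟨sup, hsupS⟩⟩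
  let u : ℝ → ℝ := fun t => ⨅ w : S, w.1 t
  have hbdd : ∀ t, BddBelow (range fun w : S => w.1 t) := by
    intro t
    refine ⟨sub t, ?_⟩
    rintro _ ⟨w, rfl⟩
    exact w.2.2.1 t
  have hule : ∀ w ∈ S, ∀ t, u t ≤ w t := fun w hw t => ciInf_le (hbdd t) ⟨w, hw⟩
  have hleu : ∀ t c, (∀ w ∈ S, c ≤ w t) → c ≤ u t := fun t c h => le_ciInf fun w => h w.1 w.2
  have huanti : Antitone u := fun x y hxy =>
    hleu _ _ fun w hw => (hule w hw y).trans (hw.1 hxy)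
  have husub : ∀ t, sub t ≤ u t := fun t => hleu _ _ fun w hw => hw.2.1 t
  have husup : ∀ t, u t ≤ sup t := fun t => hule _ hsupS t
  have hQu : ∀ t, Q u t ≤ u t := fun t => hleu _ _ fun w hw =>
    (hQmono u w huanti hw.1 (hule w hw) t).trans (hw.2.2.2 t)
  have hQuS : Q u ∈ S := ⟨hQanti u huanti, hQsub u huanti husub,
    fun t => (hQu t).trans (husup t), hQmono _ _ (hQanti u huanti) huanti hQu⟩
  have hfix : ∀ t, u t = Q u t := fun t => le_antisymm (hule _ hQuS t) (hQu t)
  have hu0 : ∀ t, 0 ≤ u t := fun t => (hsub0 t).trans (husub t)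
  have huD : ∀ t, u t ≤ D := fun t => (husup t).trans (min_le_left _ _)
  refine ⟨u, huanti, fun t => ⟨hu0 t, huD t⟩, hfix, ?_, ?_⟩
  · have hL := tendsto_atBot_ciSup huanti ⟨D, by rintro _ ⟨t, rfl⟩; exact huD t⟩
    set L := ⨆ i, u i with hLdef
    have hLge : ∀ t, u t ≤ L := fun t => le_ciSup (f := u) ⟨D, by rintro _ ⟨t, rfl⟩; exact huD t⟩ t
    have hLD : L ≤ D := ciSup_le huD
    have hle : L ≤ G L := by
      apply ciSup_le
      intro t
      rw [hfix]
      have h1 := intervalIntegral.integral_mono_on zero_le_one (hint u huanti t)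
        (intervalIntegrable_const (c := G L)) (fun s _ => hGm (hLge _))
      simpa using h1
    have hge : G L ≤ L := by
      have hG : Tendsto (fun t => G (u t)) atBot (𝓝 (G L)) := (hGc.tendsto L).comp hL
      refine le_of_tendsto hG (Eventually.of_forall fun t => ?_)
      refine le_trans ?_ (hLge (t - 1))
      rw [hfix (t - 1)]
      have h1 := intervalIntegral.integral_mono_on zero_le_one 
        (intervalIntegrable_const (c := G (u t))) (hint u huanti (t - 1))
          (fun s hs => hGm (huanti (by linarith [hs.2])))
      simpa using h1
    have hLpos : 0 < L := by
      -- choose t with K * E t = 1/2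
      have hx : E (Real.log (2 * K) / l) = 1 / (2 * K) := by
        simp only [hE]
        have : -l * (Real.log (2 * K) / l) = - Real.log (2 * K) := by field_simp
        rw [this, Real.exp_neg, Real.exp_log (by positivity)]; simp
      have h2 := (le_max_right 0 _).trans (husub (Real.log (2 * K) / l))
      rw [hx] at h2
      refine lt_of_lt_of_le ?_ (h2.trans (hLge _))
      have : 1 / (2 * K) - K * (1 / (2 * K)) ^ 2 = 1 / (4 * K) := by field_simp; ring
      rw [this]; positivity
    have : L = D := by
      by_contra hne
      have := hGgt L hLpos (lt_of_le_of_ne hLD hne)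
      linarith
    rw [← this]; exact hL
  · have hE0 : Tendsto E atTop (𝓝 0) := by
      apply Real.tendsto_exp_atBot.comp
      exact tendsto_id.const_mul_atTop_of_neg (by linarith)
    exact squeeze_zero hu0 (fun t => (husup t).trans (min_le_right _ _)) hE0

theorem tw_build (ℓ A c hp hm : ℝ) (φ h : ℝ → ℝ) (hℓ : 0 < ℓ) (hA : 0 < A) (hc : 0 < c)
    (hp1 : 1 < hp) (hφc : Continuous φ) (hanti : Antitone h)
    (hh : ∀ t, hp ≤ h t ∧ h t ≤ hm) (hφanti : Antitone fun t => φ (1 / h t))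
    (hcφ : ∀ t, c ≤ φ (1 / h t))
    (hfix : ∀ t, h t = ∫ s in (0:ℝ)..1, A * φ (1 / h (t + s)))
    (hbot : Tendsto h atBot (𝓝 hm)) (htop : Tendsto h atTop (𝓝 hp)) :
    ∃ W : ℝ → ℝ,
      (∀ x, W x ∈ Set.Ioo (0:ℝ) 1) ∧
      Monotone W ∧
      Differentiable ℝ W ∧
      (∀ x, deriv W x =
        W x ^ 2 / (ℓ * φ (W x)) * (φ (W x) - φ (W (x + ℓ / W x)))) ∧
      Filter.Tendsto W Filter.atBot (nhds (1 / hm)) ∧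
      Filter.Tendsto W Filter.atTop (nhds (1 / hp)) := by
  have hpos : ∀ t, 0 < h t := fun t => by linarith [(hh t).1]
  set p : ℝ → ℝ := fun t => A * φ (1 / h t) with hpdef
  have hpanti : Antitone p := fun x y hxy => mul_le_mul_of_nonneg_left (hφanti hxy) hA.le
  have hpi : ∀ x y, IntervalIntegrable p volume x y := fun x y => hpanti.intervalIntegrable
  let z : ℝ → ℝ := fun t => ℓ * ∫ s in (0:ℝ)..t, p s
  have hzc : Continuous z := continuous_const.mul (intervalIntegral.continuous_primitive hpi 0)
  have hzh : ∀ t, z (t + 1) - z t = ℓ * h t := by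
    intro t
    have h1 : h t = ∫ s in (0:ℝ)..1, p (t + s) := hfix t
    rw [h1, intervalIntegral.integral_comp_add_left (fun s => p s) t, add_zero]
    simp only [z]
    rw [← mul_sub, intervalIntegral.integral_interval_sub_left (hpi _ _) (hpi _ _)]
  have hheq : h = fun t => (z (t + 1) - z t) / ℓ := by
    funext t
    rw [hzh]; field_simp
  have hhc : Continuous h := by
    rw [hheq]; fun_prop
  have hpc : Continuous p := by
    have : Continuous fun t => 1 / h t := continuous_const.div hhc (fun t => (hpos t).ne')
    fun_prop
  have hzd : ∀ t, HasDerivAt z (ℓ * p t) t := fun t =>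
    (intervalIntegral.integral_hasDerivAt_right (hpi _ _)
      (hpc.stronglyMeasurableAtFilter _ _) hpc.continuousAt).const_mul ℓ
  have hhd : ∀ t, HasDerivAt h (p (t + 1) - p t) t := by
    intro t
    have h1 : HasDerivAt (fun t => (z (t + 1) - z t) / ℓ) ((ℓ * p (t + 1) - ℓ * p t) / ℓ) t :=
      (((hzd (t + 1)).comp_add_const t 1).sub (hzd t)).div_const ℓ
    rw [← hheq] at h1
    refine h1.congr_deriv ?_
    field_simp
  have hpp : ∀ t, A * c ≤ p t := fun t => mul_le_mul_of_nonneg_left (hcφ t) hA.le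
  have hAc : 0 < A * c := by positivity
  have hppos : ∀ t, 0 < p t := fun t => hAc.trans_le (hpp t)
  have hzs : StrictMono z := strictMono_of_deriv_pos fun t => by
    rw [(hzd t).deriv]; exact mul_pos hℓ (hppos t)
  set κ := ℓ * (A * c) with hκ
  have hκ0 : 0 < κ := by positivity
  have hz0 : z 0 = 0 := by simp [z]
  have hmon : Monotone fun t => z t - κ * t := by
    have hd : ∀ t, HasDerivAt (fun t => z t - κ * t) (ℓ * p t - κ * 1) t := fun t =>
      (hzd t).sub ((hasDerivAt_id t).const_mul κ)
    apply monotone_of_deriv_nonneg (fun t => (hd t).differentiableAt)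
    intro t
    rw [(hd t).deriv, hκ]
    have := mul_le_mul_of_nonneg_left (hpp t) hℓ.le
    linarith
  have hztop : Tendsto z atTop atTop := by
    refine tendsto_atTop_mono' _ ?_ (tendsto_id.const_mul_atTop hκ0)
    filter_upwards [eventually_ge_atTop 0] with t ht
    have := hmon ht
    simp only [hz0, mul_zero, sub_zero] at this
    simp only [id]; linarith
  have hzbot : Tendsto z atBot atBot := by
    refine tendsto_atBot_mono' _ ?_ (tendsto_id.const_mul_atBot hκ0)
    filter_upwards [eventually_le_atBot 0] with t ht
    have := hmon ht
    simp only [hz0, mul_zero, sub_zero] at this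
    simp only [id]; linarith
  have hsurj : Function.Surjective z := hzc.surjective hztop hzbot
  let e : ℝ ≃o ℝ := hzs.orderIsoOfSurjective z hsurj
  have hez : ∀ t, e t = z t := fun t => rfl
  set y : ℝ → ℝ := fun x => e.symm x with hy
  have hyz : ∀ t, y (z t) = t := fun t => e.symm_apply_apply t
  have hzy : ∀ x, z (y x) = x := fun x => e.apply_symm_apply x
  have hyc : Continuous y := e.symm.continuous
  have hyd : ∀ x, HasDerivAt y (ℓ * p (y x))⁻¹ x := fun x =>
    HasDerivAt.of_local_left_inverse hyc.continuousAt (hzd (y x))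
      (mul_pos hℓ (hppos _)).ne' (Eventually.of_forall hzy)
  have hWd : ∀ x, HasDerivAt (fun x => 1 / h (y x))
      (-((p (y x + 1) - p (y x)) * (ℓ * p (y x))⁻¹) / h (y x) ^ 2) x := by
    intro x
    have h1 : HasDerivAt (fun x => h (y x)) ((p (y x + 1) - p (y x)) * (ℓ * p (y x))⁻¹) x :=
      (hhd (y x)).comp x (hyd x)
    have h2 := h1.inv (hpos _).ne'
    simp only [one_div]
    exact h2
  refine ⟨fun x => 1 / h (y x), ?_, ?_, fun x => (hWd x).differentiableAt, ?_, ?_, ?_⟩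
  · intro x
    have := hh (y x)
    refine ⟨one_div_pos.mpr (hpos _), ?_⟩
    rw [div_lt_one (hpos _)]; linarith
  · intro a b hab
    exact one_div_le_one_div_of_le (hpos _) (hanti (e.symm.monotone hab))
  · intro x
    rw [(hWd x).deriv]
    have hshift : y (x + ℓ / (1 / h (y x))) = y x + 1 := by
      have : x + ℓ / (1 / h (y x)) = z (y x + 1) := by
        have := hzh (y x)
        rw [hzy] at this
        rw [div_div_eq_mul_div, div_one]; linarith
      rw [this, hyz]
    simp only [hshift]
    have h1 := hpos (y x)
    have h2 : 0 < φ (1 / h (y x)) := hc.trans_le (hcφ _)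
    simp only [hpdef]
    generalize φ (1 / h (y x)) = P at *
    field_simp
    ring
  · have hm0 : 0 < hm := (hpos 0).trans_le (hh 0).2
    exact (tendsto_const_nhds.div hbot hm0.ne').comp e.symm.tendsto_atBot
  · exact (tendsto_const_nhds.div htop (ne_of_gt (by linarith : 0 < hp))).comp e.symm.tendsto_atTop

set_option maxHeartbeats 1000000

/-- Existence of discrete traveling wave profiles: given
`0 < ρ₋ < ρ* < ρ₊ < 1` with `f(ρ₋) = f(ρ₊)`, there exists a differentiable,
monotone increasing `W : ℝ → (0,1)` solving the profile DDE on all of `ℝ` with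
`W → ρ₋` at `−∞` and `W → ρ₊` at `+∞`. -/
theorem exists_traveling_wave_profile
    (ℓ V c0 chat ρstar ρm ρp : ℝ)
    (hℓ : 0 < ℓ) (hV : 0 < V) (hc0 : 0 < c0) (hchat : 0 < chat)
    (φ : ℝ → ℝ) (hφs : ContDiff ℝ (⊤ : ℕ∞) φ)
    (hφ1 : φ 1 = 0) (hφ0 : φ 0 = 1)
    (hφ' : ∀ ρ ∈ Set.Icc (0:ℝ) 1, deriv φ ρ ≤ -chat)
    (f : ℝ → ℝ) (hf : ∀ ρ, f ρ = V * ρ * φ ρ)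
    (hf'' : ∀ ρ ∈ Set.Icc (0:ℝ) 1, deriv (deriv f) ρ ≤ -c0)
    (hρstar : ρstar ∈ Set.Ioo (0:ℝ) 1) (hρstarcrit : deriv f ρstar = 0)
    (hρm0 : 0 < ρm) (hρms : ρm < ρstar) (hρsp : ρstar < ρp) (hρp1 : ρp < 1)
    (hfeq : f ρm = f ρp) :
    ∃ W : ℝ → ℝ,
      (∀ x, W x ∈ Set.Ioo (0:ℝ) 1) ∧
      Monotone W ∧
      Differentiable ℝ W ∧
      (∀ x, deriv W x =
        W x ^ 2 / (ℓ * φ (W x)) * (φ (W x) - φ (W (x + ℓ / W x)))) ∧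
      Filter.Tendsto W Filter.atBot (nhds ρm) ∧
      Filter.Tendsto W Filter.atTop (nhds ρp) := by
  have hφc : Continuous φ := hφs.continuous
  have hφanti : StrictAntiOn φ (Icc 0 1) := by
    apply strictAntiOn_of_deriv_neg (convex_Icc 0 1) hφc.continuousOn
    intro x hx
    have := hφ' x (interior_subset hx)
    linarith
  have hmp : ρm < ρp := hρms.trans hρsp
  have hρp0 : 0 < ρp := hρm0.trans hmp
  have hfs : ContDiff ℝ (⊤ : ℕ∞) f := by
    have : f = fun ρ => V * ρ * φ ρ := funext hf
    rw [this]; fun_prop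
  have hfd : Differentiable ℝ f := hfs.differentiable (by simp)
  have hfs2 : ContDiff ℝ 2 f := contDiff_infty.mp hfs 2
  have hf1 : ContDiff ℝ 1 (deriv f) := by
    have h2 : ContDiff ℝ (1 + 1) f := by simpa [one_add_one_eq_two] using hfs2
    exact (contDiff_succ_iff_deriv.mp h2).2.2
  have hf1d : Differentiable ℝ (deriv f) := hf1.differentiable (by simp)
  have hf2c : Continuous (deriv (deriv f)) := hf1.continuous_deriv (by simp)
  have hφpos : ∀ x, 0 ≤ x → x < 1 → 0 < φ x := by
    intro x h0 h1
    rw [← hφ1]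
    exact hφanti ⟨h0, h1.le⟩ ⟨zero_le_one, le_rfl⟩ h1
  set B := f ρp with hB
  have hB0 : 0 < B := by
    rw [hB, hf]
    have := hφpos ρp hρp0.le hρp1
    positivity
  -- concavity facts
  have hconc : StrictConcaveOn ℝ (Icc 0 1) f := by
    apply strictConcaveOn_of_deriv2_neg' (convex_Icc 0 1) hfs.continuous.continuousOn
    intro x hx
    have := hf'' x hx
    simp only [Function.iterate_succ, Function.iterate_zero, Function.comp, id]
    linarith
  have hmI : ρm ∈ Icc (0:ℝ) 1 := ⟨hρm0.le, by linarith⟩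
  have hpI : ρp ∈ Icc (0:ℝ) 1 := ⟨hρp0.le, by linarith⟩
  have hfgt : ∀ x, ρm < x → x < ρp → B < f x := by
    intro x h1 h2
    have hs : x ∈ openSegment ℝ ρm ρp := by
      rw [openSegment_eq_Ioo hmp]; exact ⟨h1, h2⟩
    have := hconc.lt_on_openSegment hmI hpI hmp.ne hs
    rwa [hfeq, min_self] at this
  set d := deriv f ρp with hd
  have hup : ∀ x, 0 ≤ x → x ≤ ρp → f x ≤ B + d * (x - ρp) := by
    intro x h0 h1
    rcases h1.eq_or_lt with rfl | h1
    · simp [hB]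
    · have := hconc.concaveOn.le_slope_of_hasDerivAt ⟨h0, by linarith⟩ hpI h1 (hfd ρp).hasDerivAt
      rw [slope_def_field, le_div_iff₀ (by linarith)] at this
      linarith
  obtain ⟨M, hM0, hM⟩ : ∃ M : ℝ, 0 ≤ M ∧ ∀ x ∈ Icc (0:ℝ) 1, -M ≤ deriv (deriv f) x := by
    obtain ⟨x0, hx0, hmin⟩ := isCompact_Icc.exists_isMinOn (⟨0, by simp⟩ : (Icc (0:ℝ) 1).Nonempty)
      hf2c.continuousOn
    refine ⟨-deriv (deriv f) x0, ?_, fun x hx => ?_⟩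
    · linarith [hf'' x0 hx0]
    · rw [neg_neg]; exact hmin hx
  have hlow : ∀ x, 0 ≤ x → x ≤ ρp → B + d * (x - ρp) - M / 2 * (ρp - x) ^ 2 ≤ f x := by
    intro x h0 h1
    rcases h1.eq_or_lt with rfl | h1
    · simp [hB]
    · have hqd : ∀ x, HasDerivAt (fun x => f x + M / 2 * x ^ 2) (deriv f x + M * x) x := by
        intro x
        have := (hfd x).hasDerivAt.add ((hasDerivAt_pow 2 x).const_mul (M / 2))
        refine this.congr_deriv ?_
        push_cast; ring
      have hq1 : deriv (fun x => f x + M / 2 * x ^ 2) = fun x => deriv f x + M * x :=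
        funext fun x => (hqd x).deriv
      have hqd2 : ∀ x, HasDerivAt (fun x => deriv f x + M * x) (deriv (deriv f) x + M * 1) x :=
        fun x => (hf1d x).hasDerivAt.add ((hasDerivAt_id x).const_mul M)
      have hconv : ConvexOn ℝ (Icc 0 1) (fun x => f x + M / 2 * x ^ 2) := by
        apply convexOn_of_deriv2_nonneg' (convex_Icc 0 1)
        · exact fun x _ => (hqd x).differentiableAt.differentiableWithinAt
        · rw [hq1]
          exact fun x _ => (hqd2 x).differentiableAt.differentiableWithinAt
        · intro x hx
          simp only [Function.iterate_succ, Function.iterate_zero, Function.comp, id]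
          rw [hq1, (hqd2 x).deriv]
          linarith [hM x hx]
      have := hconv.slope_le_of_hasDerivAt ⟨h0, by linarith⟩ hpI h1 (hqd ρp)
      rw [slope_def_field, div_le_iff₀ (by linarith)] at this
      nlinarith
  have hd0 : d < 0 := by
    have h1 := hfgt ρstar hρms hρsp
    have h2 := hup ρstar hρstar.1.le hρsp.le
    nlinarith
  -- headway variables
  set A := V / B with hA
  have hA0 : 0 < A := by positivity
  set hp := 1 / ρp with hhp
  set hm := 1 / ρm with hhm
  have hp1 : 1 < hp := by rw [hhp, lt_div_iff₀ hρp0]; linarith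
  have hpm : hp < hm := one_div_lt_one_div_of_lt hρm0 hmp
  have hρphp : ρp * hp = 1 := by rw [hhp]; field_simp
  set D := hm - hp with hD
  have hD0 : 0 < D := by rw [hD]; linarith
  have hrange : ∀ h, hp ≤ h → h ≤ hm → ρm ≤ 1 / h ∧ 1 / h ≤ ρp := by
    intro h h1 h2
    have h0 : 0 < h := by linarith
    constructor
    · rw [le_div_iff₀ h0]
      rw [hhm, le_div_iff₀ hρm0] at h2; linarith
    · rw [div_le_iff₀ h0]
      rw [hhp, div_le_iff₀ hρp0] at h1; linarith
  have hg : ∀ h, 0 < h → A * φ (1 / h) = h * (f (1 / h) / B) := by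
    intro h h0
    rw [hf, hA]; field_simp
  let cl : ℝ → ℝ := fun v => max 0 (min v D)
  have hcl : ∀ v, 0 ≤ v → v ≤ D → cl v = v := fun v h0 h1 => by
    simp only [cl]; rw [min_eq_left h1, max_eq_right h0]
  have hclr : ∀ v, 0 ≤ cl v ∧ cl v ≤ D := fun v =>
    ⟨le_max_left _ _, max_le hD0.le (min_le_right _ _)⟩
  have hclm : Monotone cl := fun x y hxy => max_le_max le_rfl (min_le_min hxy le_rfl)
  have hclc : Continuous cl := by fun_prop
  have hφinv : ∀ h h', hp ≤ h → h ≤ h' → h' ≤ hm → φ (1 / h) ≤ φ (1 / h') := by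
    intro h h' h1 h2 h3
    obtain ⟨r1, r2⟩ := hrange h h1 (h2.trans h3)
    obtain ⟨r3, r4⟩ := hrange h' (h1.trans h2) h3
    exact hφanti.antitoneOn ⟨by linarith, by linarith⟩ ⟨by linarith, by linarith⟩
      (one_div_le_one_div_of_le (by linarith) h2)
  let G : ℝ → ℝ := fun v => A * φ (1 / (hp + cl v)) - hp
  have hGv : ∀ v, 0 ≤ v → v ≤ D → G v = (hp + v) * (f (1 / (hp + v)) / B) - hp := by
    intro v h0 h1
    simp only [G]
    rw [hcl v h0 h1, hg _ (by linarith)]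
  have hGm : Monotone G := by
    intro x y hxy
    have := hφinv (hp + cl x) (hp + cl y) (by linarith [(hclr x).1]) (by linarith [hclm hxy])
      (by linarith [(hclr y).2])
    have := mul_le_mul_of_nonneg_left this hA0.le
    simp only [G]; linarith
  have hGc : Continuous G := by
    have h1 : Continuous fun v => 1 / (hp + cl v) :=
      continuous_const.div (by fun_prop) (fun v => by linarith [(hclr v).1])
    exact (continuous_const.mul (hφc.comp h1)).sub continuous_const
  have hG0 : G 0 = 0 := by
    rw [hGv 0 le_rfl hD0.le, add_zero]
    have : 1 / hp = ρp := by rw [hhp, one_div_one_div]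
    rw [this, ← hB, div_self hB0.ne']; ring
  have hGD : G D = D := by
    rw [hGv D hD0.le le_rfl]
    have e : hp + D = hm := by rw [hD]; ring
    have : 1 / hm = ρm := by rw [hhm, one_div_one_div]
    rw [e, this, hfeq, div_self hB0.ne', hD]; ring
  have hGgt : ∀ v, 0 < v → v < D → v < G v := by
    intro v h0 h1
    rw [hGv v h0.le h1.le]
    have h2 : 0 < hp + v := by linarith
    have r1 : ρm < 1 / (hp + v) := by
      have : 1 / hm < 1 / (hp + v) := one_div_lt_one_div_of_lt h2 (by linarith)
      rwa [hhm, one_div_one_div] at this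
    have r2 : 1 / (hp + v) < ρp := by
      have : 1 / (hp + v) < 1 / hp := one_div_lt_one_div_of_lt (by linarith) (by linarith)
      rwa [hhp, one_div_one_div] at this
    have h3 : 1 < f (1 / (hp + v)) / B := by
      rw [lt_div_iff₀ hB0]; linarith [hfgt _ r1 r2]
    nlinarith
  have hxh : ∀ v, 0 ≤ v → (hp + v) * (1 / (hp + v)) = 1 := by
    intro v h0
    have : hp + v ≠ 0 := by linarith
    field_simp
  have hGu : ∀ v, 0 ≤ v → v ≤ D → G v ≤ (1 - ρp * (d / B)) * v := by
    intro v h0 h1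
    rw [hGv v h0 h1]
    obtain ⟨r1, r2⟩ := hrange (hp + v) (by linarith) (by linarith)
    have e := hxh v h0
    set x := 1 / (hp + v) with hx
    have h2 := hup x (by linarith) r2
    have h3 : f x / B ≤ 1 + d / B * (x - ρp) := by
      rw [div_le_iff₀ hB0]
      have : d / B * B = d := by field_simp
      linear_combination h2 - (x - ρp) * this
    have h4 := mul_le_mul_of_nonneg_left h3 (by linarith : 0 ≤ hp + v)
    linear_combination h4 + d / B * e - d / B * hρphp
  have hGl : ∀ v, 0 ≤ v → v ≤ D →
      (1 - ρp * (d / B)) * v - M / (2 * B) * v ^ 2 ≤ G v := by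
    intro v h0 h1
    rw [hGv v h0 h1]
    obtain ⟨r1, r2⟩ := hrange (hp + v) (by linarith) (by linarith)
    have e := hxh v h0
    set x := 1 / (hp + v) with hx
    have hx0 : 0 < x := by linarith
    have h2 := hlow x hx0.le r2
    have h3 : 1 + d / B * (x - ρp) - M / (2 * B) * (ρp - x) ^ 2 ≤ f x / B := by
      rw [le_div_iff₀ hB0]
      have t1 : d / B * B = d := by field_simp
      have t2 : M / (2 * B) * B = M / 2 := by field_simp
      linear_combination h2 + (x - ρp) * t1 - (ρp - x) ^ 2 * t2
    have h4 := mul_le_mul_of_nonneg_left h3 (by linarith : 0 ≤ hp + v)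
    have e2 : ρp - x = x * (ρp * v) := by linear_combination (-ρp) * e + x * hρphp
    have e3 : (hp + v) * (ρp - x) ^ 2 = x * ρp ^ 2 * v ^ 2 := by
      rw [e2]; linear_combination (x * ρp ^ 2 * v ^ 2) * e
    have h5 : x * ρp ^ 2 ≤ 1 := by
      have : ρp ^ 2 ≤ 1 := by nlinarith
      nlinarith
    have h6 : (hp + v) * (ρp - x) ^ 2 ≤ v ^ 2 := by
      rw [e3]; nlinarith [sq_nonneg v]
    have h7 := mul_le_mul_of_nonneg_left h6 (by positivity : 0 ≤ M / (2 * B))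
    linear_combination h4 + h7 - d / B * e + d / B * hρphp
  have ha : 1 < 1 - ρp * (d / B) := by
    have : d / B < 0 := div_neg_of_neg_of_pos hd0 hB0
    nlinarith
  obtain ⟨u, huanti, hur, hufix, hubot, hutop⟩ := tw_fixed G D _ (M / (2 * B)) hD0 ha
    (by positivity) hGm hGc hG0 hGD hGgt hGu hGl
  have hmain := tw_build ℓ A (φ ρp) hp hm φ (fun t => hp + u t) hℓ hA0
    (hφpos ρp hρp0.le hρp1) hp1 hφc
    (fun x y hxy => by simpa using huanti hxy)
    (fun t => ⟨by linarith [(hur t).1], by linarith [(hur t).2]⟩)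
    (fun x y hxy => hφinv _ _ (by linarith [(hur y).1]) (by linarith [huanti hxy])
      (by linarith [(hur x).2]))
    (fun t => by
      have := hφinv hp (hp + u t) le_rfl (by linarith [(hur t).1]) (by linarith [(hur t).2])
      rwa [hhp, one_div_one_div, ← hhp] at this)
    (fun t => by
      have hGe : ∀ s, G (u (t + s)) = A * φ (1 / (hp + u (t + s))) - hp := by
        intro s
        simp only [G]
        rw [hcl _ (hur _).1 (hur _).2]
      have hi : IntervalIntegrable (fun s => G (u (t + s))) volume 0 1 := by
        apply Antitone.intervalIntegrable
        intro x y hxy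
        exact hGm (huanti (by linarith))
      have h1 : ∫ s in (0:ℝ)..1, A * φ (1 / (hp + u (t + s)))
          = ∫ s in (0:ℝ)..1, (hp + G (u (t + s))) := by
        congr 1; funext s; rw [hGe]; ring
      change hp + u t = ∫ s in (0:ℝ)..1, A * φ (1 / (hp + u (t + s)))
      rw [h1, intervalIntegral.integral_add intervalIntegrable_const hi, ← hufix]
      simp)
    (by
      have := hubot.const_add hp
      rwa [show hp + D = hm by rw [hD]; ring] at this)
    (by simpa using hutop.const_add hp)
  rwa [hhp, hhm, one_div_one_div, one_div_one_div] at hmain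
end

section
/- Let W : ℝ → (0,1) be a twice differentiable monotone increasing solution of the DDE W'(x) = (W(x)²/(ℓ φ(W(x)))) · [φ(W(x)) − φ(W(x + ℓ/W(x)))] with lim_{x→−∞} W(x) = ρ₋, lim_{x→+∞} W(x) = ρ₊, where 0 < ρ₋ < ρ* < ρ₊ < 1, f(ρ₋) = f(ρ₊), and W(0) = ρ*. Then there exists x̄ > 0 such that W''(x) < 0 for all x ≥ x̄ and W''(x) > 0 for all x ≤ −x̄. -/
open Filter Topology

theorem aux_mvt {W p : ℝ → ℝ} (hW : ∀ s, HasDerivAt W (p s) s) {x y : ℝ} (h : x < y) :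
    ∃ s, x < s ∧ s < y ∧ W y - W x = p s * (y - x) := by
  obtain ⟨s, hs, he⟩ := exists_hasDerivAt_eq_slope W p h
    (fun t _ => (hW t).continuousAt.continuousWithinAt) (fun t _ => hW t)
  refine ⟨s, hs.1, hs.2, ?_⟩
  rw [he]; field_simp [sub_ne_zero.mpr h.ne']

/-- `p' ≤ u p` on `[x,y]`. -/
theorem aux_cmp {W p p' : ℝ → ℝ} (hW : ∀ s, HasDerivAt W (p s) s)
    (hp : ∀ s, HasDerivAt p (p' s) s) {x y u : ℝ} (hxy : x ≤ y)
    (h : ∀ s, x ≤ s → s ≤ y → p' s ≤ u * p s) :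
    p y - u * W y ≤ p x - u * W x := by
  rcases hxy.eq_or_lt with rfl | hlt
  · rfl
  obtain ⟨s, h1, h2, h3⟩ := aux_mvt (W := fun s => p s - u * W s) (p := fun s => p' s - u * p s)
    (fun s => (hp s).sub ((hW s).const_mul u)) hlt
  have := h s h1.le h2.le
  nlinarith

theorem aux_cmp' {W p p' : ℝ → ℝ} (hW : ∀ s, HasDerivAt W (p s) s)
    (hp : ∀ s, HasDerivAt p (p' s) s) {x y u : ℝ} (hxy : x ≤ y)
    (h : ∀ s, x ≤ s → s ≤ y → u * p s ≤ p' s) :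
    p x - u * W x ≤ p y - u * W y := by
  rcases hxy.eq_or_lt with rfl | hlt
  · rfl
  obtain ⟨s, h1, h2, h3⟩ := aux_mvt (W := fun s => p s - u * W s) (p := fun s => p' s - u * p s)
    (fun s => (hp s).sub ((hW s).const_mul u)) hlt
  have := h s h1.le h2.le
  nlinarith

theorem aux_up {W p p' A B c δ : ℝ → ℝ} {k d : ℝ} (hk : 0 < k) (hd : 0 < d)
    (hW : ∀ s, HasDerivAt W (p s) s) (hp : ∀ s, HasDerivAt p (p' s) s) (hpos : ∀ s, 0 < p s)
    (hWm : Monotone W)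
    (hp' : ∀ x, p' x = A x * p x + B x * p (x + δ x))
    (hc : ∀ x, p x = c x * (W (x + δ x) - W x))
    (hA : Tendsto A atTop (𝓝 (-k))) (hB : Tendsto B atTop (𝓝 k)) (hcl : Tendsto c atTop (𝓝 k))
    (hδ : Tendsto δ atTop (𝓝 d)) : ∃ u, ∀ᶠ x in atTop, p' x ≤ u * p x := by
  have e1 : ∀ᶠ x in atTop, -(k+1) < A x := hA.eventually (lt_mem_nhds (by linarith))
  have e2 : ∀ᶠ x in atTop, A x < 0 := hA.eventually (gt_mem_nhds (by linarith))
  have e3 : ∀ᶠ x in atTop, 0 < B x := hB.eventually (lt_mem_nhds hk)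
  have e4 : ∀ᶠ x in atTop, B x < k + 1 := hB.eventually (gt_mem_nhds (by linarith))
  have e5 : ∀ᶠ x in atTop, k / 2 < c x := hcl.eventually (lt_mem_nhds (by linarith))
  have e6 : ∀ᶠ x in atTop, d / 2 < δ x := hδ.eventually (lt_mem_nhds (by linarith))
  have e7 : ∀ᶠ x in atTop, δ x < 2 * d := hδ.eventually (gt_mem_nhds (by linarith))
  obtain ⟨X, hX⟩ := eventually_atTop.1 (e1.and (e2.and (e3.and (e4.and (e5.and (e6.and e7))))))
  have low : ∀ x, X ≤ x → -(k+1) * p x ≤ p' x := by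
    intro x hx
    obtain ⟨h1, h2, h3, -⟩ := hX x hx
    rw [hp']
    have := mul_pos h3 (hpos (x + δ x))
    have := hpos x
    nlinarith
  set C : ℝ := (4 / d + (k+1)) * (2 / k) with hC
  have hC0 : 0 < C := by positivity
  have hC1 : 1 ≤ C := by
    have : C = (8 / d) / k + 2 + 2 / k := by rw [hC]; field_simp; ring
    rw [this]
    have : 0 < (8 / d) / k := by positivity
    have : 0 < 2 / k := by positivity
    linarith
  have step : ∀ x t, X ≤ x → x ≤ t → t ≤ x + d / 4 → p t ≤ C * p x := by
    intro x t hx ht ht'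
    obtain ⟨h1, h2, h3, h4, h5, h6, h7⟩ := hX x hx
    obtain ⟨s, hs1, hs2, hs3⟩ := aux_mvt hW (show t < x + d / 2 by linarith)
    have hm := aux_cmp' hW hp (u := -(k+1)) hs1.le (fun r hr _ => low r (by linarith))
    have w1 : W x ≤ W t := hWm ht
    have w2 : W s ≤ W (x + d/2) := hWm hs2.le
    have w3 : W (x + d/2) ≤ W (x + δ x) := hWm (by linarith)
    set D := W (x + d/2) - W x with hD
    have hD0 : 0 ≤ D := by have := hWm hs1.le; linarith
    have i1 : D ≤ (2 / k) * p x := by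
      have : k / 2 * D ≤ p x := by
        rw [hc x]; apply mul_le_mul h5.le (by linarith) hD0 (by linarith)
      calc D = (2 / k) * (k / 2 * D) := by field_simp
        _ ≤ _ := by gcongr
    have i2 : p s * (d / 4) ≤ D := by
      have : p s * (d/4) ≤ p s * (x + d/2 - t) :=
        mul_le_mul_of_nonneg_left (by linarith) (hpos s).le
      linarith
    have i3 : p s ≤ 4 / d * D := by
      calc p s = 4 / d * (p s * (d/4)) := by field_simp
        _ ≤ _ := by gcongr
    have i4 : p t ≤ p s + (k+1) * D := by
      have : (k+1) * (W s - W t) ≤ (k+1) * D := by gcongr; linarith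
      linarith
    calc p t ≤ (4 / d + (k+1)) * D := by linarith
      _ ≤ (4 / d + (k+1)) * ((2/k) * p x) := by gcongr
      _ = C * p x := by rw [hC]; ring
  have iter : ∀ n : ℕ, ∀ x t, X ≤ x → x ≤ t → t ≤ x + n * (d / 4) → p t ≤ C ^ n * p x := by
    intro n
    induction n with
    | zero => 
      intro x t hx h1 h2
      have : t = x := by simp at h2; linarith
      simp [this]
    | succ n ih =>
      intro x t hx h1 h2
      push_cast at h2
      by_cases h : t ≤ x + d / 4
      · have a := step x t hx h1 h
        have b : C ≤ C ^ (n+1) := le_self_pow₀ hC1 (by omega)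
        have := hpos x
        nlinarith
      · have a := ih (x + d/4) t (by linarith) (by linarith) (by linarith)
        have b := step x (x + d/4) hx (by linarith) le_rfl
        calc p t ≤ C ^ n * p (x + d/4) := a
          _ ≤ C ^ n * (C * p x) := by gcongr
          _ = _ := by ring
  refine ⟨(k+1) * C ^ 8, eventually_atTop.2 ⟨X, fun x hx => ?_⟩⟩
  obtain ⟨h1, h2, h3, h4, h5, h6, h7⟩ := hX x hx
  have := iter 8 x (x + δ x) hx (by linarith) (by push_cast; linarith)
  rw [hp']
  have a : A x * p x ≤ 0 := mul_nonpos_of_nonpos_of_nonneg h2.le (hpos x).le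
  have b : B x * p (x + δ x) ≤ (k+1) * (C ^ 8 * p x) :=
    mul_le_mul h4.le this (hpos _).le (by linarith)
  linarith

theorem aux_plus {W p p' A B c δ : ℝ → ℝ} {k d : ℝ} (hk : 0 < k) (hd : 0 < d) (hkd : 1 < k * d)
    (hW : ∀ s, HasDerivAt W (p s) s) (hp : ∀ s, HasDerivAt p (p' s) s) (hpos : ∀ s, 0 < p s)
    (hWm : Monotone W)
    (hp' : ∀ x, p' x = A x * p x + B x * p (x + δ x))
    (hc : ∀ x, p x = c x * (W (x + δ x) - W x))
    (hA : Tendsto A atTop (𝓝 (-k))) (hB : Tendsto B atTop (𝓝 k)) (hcl : Tendsto c atTop (𝓝 k))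
    (hδ : Tendsto δ atTop (𝓝 d)) : ∀ᶠ x in atTop, p' x < 0 := by
  by_contra hcon
  set S : Set ℝ := {u | ∀ᶠ x in atTop, p' x ≤ u * p x} with hS
  have hne : S.Nonempty := aux_up hk hd hW hp hpos hWm hp' hc hA hB hcl hδ
  have hlb : ∀ u ∈ S, 0 ≤ u := by
    intro u hu
    by_contra h
    push Not at h
    exact hcon (hu.mono fun x hx => hx.trans_lt (mul_neg_of_neg_of_pos h (hpos x)))
  have hbdd : BddBelow S := ⟨0, hlb⟩
  set Q := sInf S with hQ
  have hQ0 : 0 ≤ Q := le_csInf hne hlb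
  have key : ∀ ε > 0, k * (1 + (Q + ε) * d) ≥ k * d * (Q - ε + k) := by
    intro ε hε
    have h1 : ∀ᶠ x in atTop, p' x ≤ (Q + ε) * p x := by
      obtain ⟨u, hu, hlt⟩ := exists_lt_of_csInf_lt hne (show sInf S < Q + ε by linarith)
      exact hu.mono fun x hx => hx.trans (mul_le_mul_of_nonneg_right hlt.le (hpos x).le)
    have h2 : ∃ᶠ x in atTop, (Q - ε) * p x < p' x := by
      intro h
      have : Q - ε ∈ S := h.mono fun x hx => not_lt.1 hx
      have := csInf_le hbdd this
      linarith
    have e3 : ∀ᶠ x in atTop, 0 < B x := hB.eventually (lt_mem_nhds hk)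
    have e5 : ∀ᶠ x in atTop, 0 < c x := hcl.eventually (lt_mem_nhds hk)
    have e6 : ∀ᶠ x in atTop, 0 < δ x := hδ.eventually (lt_mem_nhds hd)
    have t1 : Tendsto (fun x => B x * (1 + (Q + ε) * δ x)) atTop (𝓝 (k * (1 + (Q + ε) * d))) :=
      hB.mul ((hδ.const_mul _).const_add 1)
    have t2 : Tendsto (fun x => c x * δ x * (Q - ε - A x)) atTop (𝓝 (k * d * (Q - ε - -k))) :=
      (hcl.mul hδ).mul (hA.const_sub _)
    have fr : ∃ᶠ x in atTop, c x * δ x * (Q - ε - A x) ≤ B x * (1 + (Q + ε) * δ x) := by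
      refine (h2.and_eventually ((eventually_forall_ge_atTop.2 h1).and (e3.and (e5.and e6)))).mono ?_
      rintro x ⟨g1, g2, g3, g4, g5⟩
      obtain ⟨s, hs1, hs2, hs3⟩ := aux_mvt hW (show x < x + δ x by linarith)
      have hm := aux_cmp hW hp (u := Q + ε) hs2.le (fun r hr _ => g2 r (by linarith))
      have w1 : W x ≤ W s := hWm hs1.le
      have i1 : p (x + δ x) - (Q + ε) * (W (x + δ x) - W x) ≤ p s := by
        have : (Q + ε) * W x ≤ (Q + ε) * W s := mul_le_mul_of_nonneg_left w1 (by linarith)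
        linarith
      have i2 : δ x * p (x + δ x) ≤ (1 + (Q + ε) * δ x) * (W (x + δ x) - W x) := by
        have : (p (x + δ x) - (Q + ε) * (W (x + δ x) - W x)) * δ x ≤ p s * δ x := by gcongr
        have e : p s * δ x = W (x + δ x) - W x := by rw [hs3]; ring
        linarith
      have i3 : c x * δ x * p (x + δ x) ≤ (1 + (Q + ε) * δ x) * p x := by
        have := mul_le_mul_of_nonneg_left i2 g4.le
        calc _ = c x * (δ x * p (x + δ x)) := by ring
          _ ≤ _ := this
          _ = (1 + (Q + ε) * δ x) * (c x * (W (x + δ x) - W x)) := by ring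
          _ = _ := by rw [← hc]
      have i4 : (Q - ε - A x) * p x ≤ B x * p (x + δ x) := by
        have := hp' x; linarith
      refine le_of_mul_le_mul_right ?_ (hpos x)
      calc c x * δ x * (Q - ε - A x) * p x = (c x * δ x) * ((Q - ε - A x) * p x) := by ring
        _ ≤ (c x * δ x) * (B x * p (x + δ x)) := by gcongr
        _ = B x * (c x * δ x * p (x + δ x)) := by ring
        _ ≤ B x * ((1 + (Q + ε) * δ x) * p x) := by gcongr
        _ = _ := by ring
    have := le_of_tendsto_of_tendsto_of_frequently t2 t1 fr
    linarith
  have h := key ((k * d - 1) / (4 * d)) (by apply div_pos <;> linarith)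
  set ε := (k * d - 1) / (4 * d) with hε
  have he : ε * d = (k * d - 1) / 4 := by rw [hε]; field_simp
  have h' : k * (d * (Q - ε + k)) ≤ k * (1 + (Q + ε) * d) := by linarith
  have := le_of_mul_le_mul_left h' hk
  nlinarith

theorem aux_minus {W p p' A B c δ : ℝ → ℝ} {k d : ℝ} (hk : 0 < k) (hd : 0 < d) (hkd : k * d < 1)
    (hW : ∀ s, HasDerivAt W (p s) s) (hp : ∀ s, HasDerivAt p (p' s) s) (hpos : ∀ s, 0 < p s)
    (hWm : Monotone W)
    (hp' : ∀ x, p' x = A x * p x + B x * p (x + δ x))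
    (hc : ∀ x, p x = c x * (W (x + δ x) - W x))
    (hA : Tendsto A atBot (𝓝 (-k))) (hB : Tendsto B atBot (𝓝 k)) (hcl : Tendsto c atBot (𝓝 k))
    (hδ : Tendsto δ atBot (𝓝 d)) : ∀ᶠ x in atBot, 0 < p' x := by
  by_contra hcon
  set S : Set ℝ := {u | ∀ᶠ x in atBot, u * p x ≤ p' x} with hS
  have e3 : ∀ᶠ x in atBot, 0 < B x := hB.eventually (lt_mem_nhds hk)
  have hne : S.Nonempty := by
    refine ⟨-(k+1), ?_⟩
    have e1 : ∀ᶠ x in atBot, -(k+1) < A x := hA.eventually (lt_mem_nhds (by linarith))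
    filter_upwards [e1, e3] with x h1 h3
    rw [hp']
    have := mul_pos h3 (hpos (x + δ x))
    have := hpos x
    nlinarith
  have hlb : ∀ u ∈ S, u ≤ 0 := by
    intro u hu
    by_contra h
    push Not at h
    exact hcon (hu.mono fun x hx => (mul_pos h (hpos x)).trans_le hx)
  have hbdd : BddAbove S := ⟨0, hlb⟩
  set Q := sSup S with hQ
  have hQ0 : Q ≤ 0 := csSup_le hne hlb
  have key : ∀ ε > 0, k * (1 + (Q - ε) * d) ≤ k * d * (Q + ε + k) := by
    intro ε hε
    have h1 : ∀ᶠ x in atBot, (Q - ε) * p x ≤ p' x := by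
      obtain ⟨u, hu, hlt⟩ := exists_lt_of_lt_csSup hne (show Q - ε < sSup S by linarith)
      exact hu.mono fun x hx => (mul_le_mul_of_nonneg_right hlt.le (hpos x).le).trans hx
    have h2 : ∃ᶠ x in atBot, p' x < (Q + ε) * p x := by
      intro h
      have : Q + ε ∈ S := h.mono fun x hx => not_lt.1 hx
      have := le_csSup hbdd this
      linarith
    have e5 : ∀ᶠ x in atBot, 0 < c x := hcl.eventually (lt_mem_nhds hk)
    have e6 : ∀ᶠ x in atBot, 0 < δ x := hδ.eventually (lt_mem_nhds hd)
    have e7 : ∀ᶠ x in atBot, δ x < 2 * d := hδ.eventually (gt_mem_nhds (by linarith))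
    have t1 : Tendsto (fun x => B x * (1 + (Q - ε) * δ x)) atBot (𝓝 (k * (1 + (Q - ε) * d))) :=
      hB.mul ((hδ.const_mul _).const_add 1)
    have t2 : Tendsto (fun x => c x * δ x * (Q + ε - A x)) atBot (𝓝 (k * d * (Q + ε - -k))) :=
      (hcl.mul hδ).mul (hA.const_sub _)
    obtain ⟨X, hX⟩ := eventually_atBot.1 h1
    have fr : ∃ᶠ x in atBot, B x * (1 + (Q - ε) * δ x) ≤ c x * δ x * (Q + ε - A x) := by
      refine (h2.and_eventually ((eventually_le_atBot (X - 2 * d)).and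
        (e3.and (e5.and (e6.and e7))))).mono ?_
      rintro x ⟨g1, g2, g3, g4, g5, g6⟩
      obtain ⟨s, hs1, hs2, hs3⟩ := aux_mvt hW (show x < x + δ x by linarith)
      have hm := aux_cmp' hW hp (u := Q - ε) hs2.le (fun r _ hr => hX r (by linarith))
      have w1 : W x ≤ W s := hWm hs1.le
      have i1 : p s ≤ p (x + δ x) - (Q - ε) * (W (x + δ x) - W x) := by
        have : (Q - ε) * W s ≤ (Q - ε) * W x := mul_le_mul_of_nonpos_left w1 (by linarith)
        linarith
      have i2 : (1 + (Q - ε) * δ x) * (W (x + δ x) - W x) ≤ δ x * p (x + δ x) := by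
        have : p s * δ x ≤ (p (x + δ x) - (Q - ε) * (W (x + δ x) - W x)) * δ x := by gcongr
        have e : p s * δ x = W (x + δ x) - W x := by rw [hs3]; ring
        linarith
      have i3 : (1 + (Q - ε) * δ x) * p x ≤ c x * δ x * p (x + δ x) := by
        have := mul_le_mul_of_nonneg_left i2 g4.le
        calc _ = (1 + (Q - ε) * δ x) * (c x * (W (x + δ x) - W x)) := by rw [← hc]
          _ = c x * ((1 + (Q - ε) * δ x) * (W (x + δ x) - W x)) := by ring
          _ ≤ _ := this
          _ = _ := by ring
      have i4 : B x * p (x + δ x) ≤ (Q + ε - A x) * p x := by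
        have := hp' x; linarith
      refine le_of_mul_le_mul_right ?_ (hpos x)
      calc B x * (1 + (Q - ε) * δ x) * p x = B x * ((1 + (Q - ε) * δ x) * p x) := by ring
        _ ≤ B x * (c x * δ x * p (x + δ x)) := by gcongr
        _ = (c x * δ x) * (B x * p (x + δ x)) := by ring
        _ ≤ (c x * δ x) * ((Q + ε - A x) * p x) := by gcongr
        _ = _ := by ring
    have := le_of_tendsto_of_tendsto_of_frequently t1 t2 fr
    linarith
  have h := key ((1 - k * d) / (4 * d)) (by apply div_pos <;> linarith)
  set ε := (1 - k * d) / (4 * d) with hε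
  have he : ε * d = (1 - k * d) / 4 := by rw [hε]; field_simp
  have h' : k * (1 + (Q - ε) * d) ≤ k * (d * (Q + ε + k)) := by linarith
  have := le_of_mul_le_mul_left h' hk
  nlinarith

theorem aux_limits {φ W ξ : ℝ → ℝ} {ℓ ρ : ℝ} {l : Filter ℝ} (hℓ : 0 < ℓ) (hρ : 0 < ρ)
    (hφρ : 0 < φ ρ) (hφ : Continuous φ) (hφ' : Continuous (deriv φ))
    (h1 : Tendsto W l (𝓝 ρ)) (h2 : Tendsto (fun x => W (x + ℓ / W x)) l (𝓝 ρ))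
    (h3 : Tendsto ξ l (𝓝 ρ)) :
    Tendsto (fun x => (2 * W x * (ℓ * φ (W x)) - W x ^ 2 * (ℓ * deriv φ (W x))) /
      (ℓ * φ (W x)) ^ 2 * (φ (W x) - φ (W (x + ℓ / W x))) +
      W x ^ 2 / (ℓ * φ (W x)) * deriv φ (W x)) l (𝓝 (-(-(ρ ^ 2 / (ℓ * φ ρ) * deriv φ ρ)))) ∧
    Tendsto (fun x => -(W x ^ 2 / (ℓ * φ (W x)) * deriv φ (W (x + ℓ / W x)) *
      (φ (W (x + ℓ / W x)) / φ (W x)))) l (𝓝 (-(ρ ^ 2 / (ℓ * φ ρ) * deriv φ ρ))) ∧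
    Tendsto (fun x => -(W x ^ 2 / (ℓ * φ (W x)) * deriv φ (ξ x))) l
      (𝓝 (-(ρ ^ 2 / (ℓ * φ ρ) * deriv φ ρ))) ∧
    Tendsto (fun x => ℓ / W x) l (𝓝 (ℓ / ρ)) := by
  have a1 : Tendsto (fun x => φ (W x)) l (𝓝 (φ ρ)) := (hφ.tendsto ρ).comp h1
  have a2 : Tendsto (fun x => φ (W (x + ℓ / W x))) l (𝓝 (φ ρ)) := (hφ.tendsto ρ).comp h2
  have b1 : Tendsto (fun x => deriv φ (W x)) l (𝓝 (deriv φ ρ)) := (hφ'.tendsto ρ).comp h1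
  have b2 : Tendsto (fun x => deriv φ (W (x + ℓ / W x))) l (𝓝 (deriv φ ρ)) :=
    (hφ'.tendsto ρ).comp h2
  have b3 : Tendsto (fun x => deriv φ (ξ x)) l (𝓝 (deriv φ ρ)) := (hφ'.tendsto ρ).comp h3
  have hh : Tendsto (fun x => W x ^ 2 / (ℓ * φ (W x))) l (𝓝 (ρ ^ 2 / (ℓ * φ ρ))) :=
    (h1.pow 2).div (a1.const_mul ℓ) (by positivity)
  refine ⟨?_, ?_, (hh.mul b3).neg, tendsto_const_nhds.div h1 hρ.ne'⟩
  · have := (((((h1.const_mul 2).mul (a1.const_mul ℓ)).sub ((h1.pow 2).mul (b1.const_mul ℓ))).div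
      ((a1.const_mul ℓ).pow 2) (by positivity)).mul (a1.sub a2)).add (hh.mul b1)
    have e : -(-(ρ ^ 2 / (ℓ * φ ρ) * deriv φ ρ)) =
        (2 * ρ * (ℓ * φ ρ) - ρ ^ 2 * (ℓ * deriv φ ρ)) / (ℓ * φ ρ) ^ 2 * (φ ρ - φ ρ) +
        ρ ^ 2 / (ℓ * φ ρ) * deriv φ ρ := by ring
    rw [e]; exact this
  · have := ((hh.mul b2).mul (a2.div a1 hφρ.ne')).neg
    have e : -(ρ ^ 2 / (ℓ * φ ρ) * deriv φ ρ) =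
        -(ρ ^ 2 / (ℓ * φ ρ) * deriv φ ρ * (φ ρ / φ ρ)) := by rw [div_self hφρ.ne', mul_one]
    rw [e]; exact this


/-- A twice differentiable monotone increasing solution of the
profile DDE with limits `ρ₋`, `ρ₊` (`0 < ρ₋ < ρ* < ρ₊ < 1`, `f(ρ₋) = f(ρ₊)`)
normalized by `W(0) = ρ*` is eventually concave at `+∞` and eventually convex
at `−∞`: there is `x̄ > 0` with `W'' < 0` on `[x̄, ∞)` and `W'' > 0` on
`(−∞, −x̄]`. -/
theorem profile_eventually_concave_convex
    (ℓ V c0 chat ρstar ρm ρp : ℝ)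
    (hℓ : 0 < ℓ) (hV : 0 < V) (hc0 : 0 < c0) (hchat : 0 < chat)
    (φ : ℝ → ℝ) (hφs : ContDiff ℝ (⊤ : ℕ∞) φ)
    (hφ1 : φ 1 = 0) (hφ0 : φ 0 = 1)
    (hφ' : ∀ ρ ∈ Set.Icc (0:ℝ) 1, deriv φ ρ ≤ -chat)
    (f : ℝ → ℝ) (hf : ∀ ρ, f ρ = V * ρ * φ ρ)
    (hf'' : ∀ ρ ∈ Set.Icc (0:ℝ) 1, deriv (deriv f) ρ ≤ -c0)
    (hρstar : ρstar ∈ Set.Ioo (0:ℝ) 1) (hρstarcrit : deriv f ρstar = 0)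
    (hρm0 : 0 < ρm) (hρms : ρm < ρstar) (hρsp : ρstar < ρp) (hρp1 : ρp < 1)
    (hfeq : f ρm = f ρp)
    (W : ℝ → ℝ) (hWmem : ∀ x, W x ∈ Set.Ioo (0:ℝ) 1)
    (hWmono : Monotone W) (hWd : Differentiable ℝ W)
    (hWd2 : Differentiable ℝ (deriv W))
    (hdde : ∀ x, deriv W x =
      W x ^ 2 / (ℓ * φ (W x)) * (φ (W x) - φ (W (x + ℓ / W x))))
    (hWlimm : Filter.Tendsto W Filter.atBot (nhds ρm))
    (hWlimp : Filter.Tendsto W Filter.atTop (nhds ρp))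
    (hW0 : W 0 = ρstar) :
    ∃ xbar : ℝ, 0 < xbar ∧
      (∀ x, xbar ≤ x → deriv (deriv W) x < 0) ∧
      (∀ x, x ≤ -xbar → 0 < deriv (deriv W) x) := by
  classical
  have hφd : Differentiable ℝ φ := hφs.differentiable (by simp)
  have hφc : Continuous φ := hφd.continuous
  have hφ'c : Continuous (deriv φ) := hφs.continuous_deriv (by simp)
  -- `φ` strictly decreasing
  have hanti : StrictAntiOn φ (Set.Icc 0 1) := by
    apply strictAntiOn_of_deriv_neg (convex_Icc 0 1) hφc.continuousOn
    intro x hx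
    rw [interior_Icc] at hx
    have := hφ' x ⟨hx.1.le, hx.2.le⟩
    linarith
  have hφpos : ∀ w, 0 ≤ w → w < 1 → 0 < φ w := by
    intro w h0 h1
    have := hanti ⟨h0, h1.le⟩ ⟨zero_le_one, le_rfl⟩ h1
    linarith
  have hW0' : ∀ x, 0 < W x := fun x => (hWmem x).1
  have hWIcc : ∀ x, W x ∈ Set.Icc (0:ℝ) 1 := fun x => ⟨(hWmem x).1.le, (hWmem x).2.le⟩
  have hφW : ∀ x, 0 < φ (W x) := fun x => hφpos _ (hWmem x).1.le (hWmem x).2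
  have hWp : ∀ s, HasDerivAt W (deriv W s) s := fun s => (hWd s).hasDerivAt
  have hy : ∀ x, x + ℓ < x + ℓ / W x := by
    intro x
    have : ℓ < ℓ / W x := by
      rw [lt_div_iff₀ (hW0' x)]; nlinarith [(hWmem x).2]
    linarith
  have hWlt : ∀ x, W x ≤ ρp := fun x => hWmono.ge_of_tendsto hWlimp x
  have hWgt : ∀ x, ρm ≤ W x := fun x => hWmono.le_of_tendsto hWlimm x
  have hρpI : ρp ∈ Set.Icc (0:ℝ) 1 := ⟨by linarith, hρp1.le⟩
  have hφρp : 0 < φ ρp := hφpos _ hρpI.1 hρp1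
  have hφρm : 0 < φ ρm := hφpos _ hρm0.le (by linarith)
  -- MVT for `φ`
  have hmv : ∀ a b, a ≤ b → ∃ z, a ≤ z ∧ z ≤ b ∧ φ b - φ a = deriv φ z * (b - a) := by
    intro a b hab
    rcases hab.eq_or_lt with rfl | h
    · exact ⟨a, le_rfl, le_rfl, by simp⟩
    · obtain ⟨s, h1, h2, h3⟩ := aux_mvt (fun s => (hφd s).hasDerivAt) h
      exact ⟨s, h1.le, h2.le, h3⟩
  -- strict bound
  have hWlt' : ∀ x, W x < ρp := by
    obtain ⟨M, hM⟩ := (isCompact_Icc (a := (0:ℝ)) (b := 1)).exists_bound_of_continuousOn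
      hφ'c.continuousOn
    have hM0 : 0 ≤ M := (norm_nonneg _).trans (hM 0 (by simp))
    set L := 1 / (ℓ * φ ρp) * M with hL
    have hbd : ∀ x, deriv W x ≤ L * (ρp - W x) := by
      intro x
      rw [hdde x]
      obtain ⟨z, hz1, hz2, hz3⟩ := hmv (W x) ρp (hWlt x)
      have i1 : φ ρp ≤ φ (W (x + ℓ / W x)) := hanti.antitoneOn (hWIcc _) hρpI (hWlt _)
      have i2 : φ ρp ≤ φ (W x) := hanti.antitoneOn (hWIcc _) hρpI (hWlt _)
      have i3 : φ (W x) - φ (W (x + ℓ / W x)) ≤ M * (ρp - W x) := by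
        have := hM z ⟨(hW0' x).le.trans hz1, hz2.trans hρp1.le⟩
        have := (abs_le.1 this).1
        have : -M * (ρp - W x) ≤ deriv φ z * (ρp - W x) :=
          mul_le_mul_of_nonneg_right this (by linarith [hWlt x])
        linarith
      have i4 : W x ^ 2 / (ℓ * φ (W x)) ≤ 1 / (ℓ * φ ρp) := by
        have : W x ^ 2 ≤ 1 := pow_le_one₀ (hW0' x).le (hWmem x).2.le
        gcongr
      have i5 : 0 ≤ φ (W x) - φ (W (x + ℓ / W x)) := by
        have := hanti.antitoneOn (hWIcc x) (hWIcc _) (hWmono (show x ≤ x + ℓ / W x by linarith [hy x]))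
        linarith
      calc _ ≤ 1 / (ℓ * φ ρp) * (M * (ρp - W x)) :=
            mul_le_mul i4 i3 i5 (by positivity)
        _ = _ := by rw [hL]; ring
    have hmonoE : Monotone (fun x => (ρp - W x) * Real.exp (L * x)) := by
      have hd : ∀ x, HasDerivAt (fun x => (ρp - W x) * Real.exp (L * x))
          ((-deriv W x) * Real.exp (L * x) + (ρp - W x) * (Real.exp (L * x) * (L * 1))) x := by
        intro x
        exact ((hWp x).const_sub ρp).mul (((hasDerivAt_id x).const_mul L).exp)
      apply monotone_of_deriv_nonneg (fun x => (hd x).differentiableAt)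
      intro x
      rw [(hd x).deriv]
      have := hbd x
      have e := Real.exp_pos (L * x)
      have : 0 ≤ (L * (ρp - W x) - deriv W x) * Real.exp (L * x) :=
        mul_nonneg (by linarith) e.le
      linarith
    intro x
    refine lt_of_le_of_ne (hWlt x) fun hx => ?_
    have h0x : ∀ z, z ≤ x → W z = ρp := by
      intro z hz
      have := hmonoE hz
      simp only [hx, sub_self, zero_mul] at this
      have e := Real.exp_pos (L * z)
      have := nonpos_of_mul_nonpos_left this e
      linarith [hWlt z]
    have h1 := h0x (min 0 x) (min_le_right _ _)
    have h2 := hWmono (min_le_left 0 x)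
    linarith
  -- positivity of the derivative
  have hp0 : ∀ x, 0 ≤ deriv W x := fun x => hWmono.deriv_nonneg
  have hpos : ∀ x, 0 < deriv W x := by
    intro x
    refine lt_of_le_of_ne (hp0 x) fun hx => ?_
    have step : ∀ x, deriv W x = 0 → deriv W (x + ℓ / 2) = 0 ∧ W (x + ℓ / 2) = W x := by
      intro x hx
      have h1 := hdde x
      rw [hx] at h1
      have hh : 0 < W x ^ 2 / (ℓ * φ (W x)) := by
        have := hW0' x; have := hφW x; positivity
      have h2 : φ (W x) - φ (W (x + ℓ / W x)) = 0 := by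
        rcases mul_eq_zero.1 h1.symm with h | h
        · exact absurd h hh.ne'
        · exact h
      have h3 : W x = W (x + ℓ / W x) := hanti.injOn (hWIcc _) (hWIcc _) (by linarith)
      have h4 : ∀ s, x ≤ s → s ≤ x + ℓ → W s = W x := by
        intro s hs1 hs2
        have := hWmono hs1
        have := hWmono (show s ≤ x + ℓ / W x by linarith [hy x])
        linarith
      refine ⟨?_, h4 _ (by linarith) (by linarith)⟩
      have : W =ᶠ[𝓝 (x + ℓ / 2)] fun _ => W x := by
        filter_upwards [Icc_mem_nhds (show x < x + ℓ/2 by linarith) (show x + ℓ/2 < x + ℓ by linarith)]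
          with s hs
        exact h4 s hs.1 hs.2
      rw [this.deriv_eq]; simp
    have it : ∀ n : ℕ, deriv W (x + n * (ℓ / 2)) = 0 ∧ W (x + n * (ℓ / 2)) = W x := by
      intro n
      induction n with
      | zero => simpa using hx.symm
      | succ n ih =>
        obtain ⟨a, b⟩ := step _ ih.1
        have e : x + ((n + 1 : ℕ) : ℝ) * (ℓ / 2) = x + n * (ℓ / 2) + ℓ / 2 := by push_cast; ring
        rw [e]; exact ⟨a, b.trans ih.2⟩
    have ht : Tendsto (fun n : ℕ => x + (n : ℝ) * (ℓ / 2)) atTop atTop :=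
      tendsto_atTop_add_const_left _ _ (tendsto_natCast_atTop_atTop.atTop_mul_const (by positivity))
    have h1 := hWlimp.comp ht
    have h2 : (W ∘ fun n : ℕ => x + (n : ℝ) * (ℓ / 2)) = fun _ => W x := by
      funext n; exact (it n).2
    rw [h2] at h1
    have := tendsto_nhds_unique h1 tendsto_const_nhds
    linarith [hWlt' x]
  -- choice of intermediate points
  have hxy : ∀ x, W x ≤ W (x + ℓ / W x) := fun x => hWmono (by linarith [hy x])
  choose ξ hξ1 hξ2 hξ3 using fun x => hmv _ _ (hxy x)
  have hc : ∀ x, deriv W x = -(W x ^ 2 / (ℓ * φ (W x)) * deriv φ (ξ x)) *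
      (W (x + ℓ / W x) - W x) := by
    intro x
    rw [hdde x]
    have := hξ3 x
    have e : φ (W x) - φ (W (x + ℓ / W x)) = -(deriv φ (ξ x) * (W (x + ℓ / W x) - W x)) := by
      linarith
    rw [e]; ring
  have hpd : ∀ s, HasDerivAt (deriv W) (deriv (deriv W) s) s := fun s => (hWd2 s).hasDerivAt
  have hp' : ∀ x, deriv (deriv W) x =
      ((2 * W x * (ℓ * φ (W x)) - W x ^ 2 * (ℓ * deriv φ (W x))) /
      (ℓ * φ (W x)) ^ 2 * (φ (W x) - φ (W (x + ℓ / W x))) +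
      W x ^ 2 / (ℓ * φ (W x)) * deriv φ (W x)) * deriv W x +
      (-(W x ^ 2 / (ℓ * φ (W x)) * deriv φ (W (x + ℓ / W x)) *
      (φ (W (x + ℓ / W x)) / φ (W x)))) * deriv W (x + ℓ / W x) := by
    intro x
    have hw := hW0' x
    have hf0 := hφW x
    have hyd : HasDerivAt (fun x => x + ℓ / W x) (φ (W (x + ℓ / W x)) / φ (W x)) x := by
      have := (hasDerivAt_id x).add ((hasDerivAt_const x ℓ).div (hWp x) hw.ne')
      refine this.congr_deriv ?_
      rw [hdde x]
      field_simp
      ring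
    have hφW1 : HasDerivAt (fun x => φ (W x)) (deriv φ (W x) * deriv W x) x :=
      (hφd (W x)).hasDerivAt.comp x (hWp x)
    have hWy : HasDerivAt (fun x => W (x + ℓ / W x))
        (deriv W (x + ℓ / W x) * (φ (W (x + ℓ / W x)) / φ (W x))) x :=
      (hWp (x + ℓ / W x)).comp x hyd
    have hφWy : HasDerivAt (fun x => φ (W (x + ℓ / W x)))
        (deriv φ (W (x + ℓ / W x)) * (deriv W (x + ℓ / W x) * (φ (W (x + ℓ / W x)) / φ (W x)))) x :=
      (hφd (W (x + ℓ / W x))).hasDerivAt.comp x hWy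
    have hmain := (((hWp x).pow 2).div (hφW1.const_mul ℓ) (by positivity)).mul (hφW1.sub hφWy)
    have hfun : deriv W = fun x => W x ^ 2 / (ℓ * φ (W x)) * (φ (W x) - φ (W (x + ℓ / W x))) :=
      funext hdde
    have h2 := (hpd x).unique (hmain.congr_of_eventuallyEq (Eventually.of_forall fun z => hdde z))
    rw [h2]
    simp only [Pi.pow_apply, Pi.div_apply, Pi.sub_apply]
    push_cast
    ring
  -- the derivative of the flux
  have hfd : ∀ w, HasDerivAt f (V * (φ w + w * deriv φ w)) w := by
    intro w
    have : f = fun w => V * w * φ w := funext hf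
    rw [this]
    refine ((((hasDerivAt_id w).const_mul V)).mul (hφd w).hasDerivAt).congr_deriv ?_
    simp; ring
  have hf' : deriv f = fun w => V * (φ w + w * deriv φ w) := funext fun w => (hfd w).deriv
  have hfanti : StrictAntiOn (deriv f) (Set.Icc 0 1) := by
    apply strictAntiOn_of_deriv_neg (convex_Icc 0 1)
    · rw [hf']; fun_prop
    · intro x hx
      rw [interior_Icc] at hx
      have := hf'' x ⟨hx.1.le, hx.2.le⟩
      linarith
  have hsI : ρstar ∈ Set.Icc (0:ℝ) 1 := ⟨hρstar.1.le, hρstar.2.le⟩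
  have hmI : ρm ∈ Set.Icc (0:ℝ) 1 := ⟨hρm0.le, by linarith⟩
  have hfp : φ ρp + ρp * deriv φ ρp < 0 := by
    have := hfanti hsI hρpI hρsp
    rw [hρstarcrit, hf'] at this
    exact neg_of_mul_neg_right this hV.le
  have hfm : 0 < φ ρm + ρm * deriv φ ρm := by
    have := hfanti hmI hsI hρms
    rw [hρstarcrit, hf'] at this
    exact pos_of_mul_pos_right this hV.le
  have hρp0 : 0 < ρp := by linarith
  have hkpos : ∀ ρ, 0 < ρ → ρ ∈ Set.Icc (0:ℝ) 1 → 0 < φ ρ →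
      0 < -(ρ ^ 2 / (ℓ * φ ρ) * deriv φ ρ) := by
    intro ρ h0 h1 h2
    have := hφ' ρ h1
    have h3 : 0 < ρ ^ 2 / (ℓ * φ ρ) := by positivity
    have := mul_neg_of_pos_of_neg h3 (show deriv φ ρ < 0 by linarith)
    linarith
  have hkd : ∀ ρ, 0 < ρ → 0 < φ ρ →
      -(ρ ^ 2 / (ℓ * φ ρ) * deriv φ ρ) * (ℓ / ρ) = -(ρ * deriv φ ρ) / φ ρ := by
    intro ρ h0 h2
    field_simp
  -- limits
  have hWyp : Tendsto (fun x => W (x + ℓ / W x)) atTop (𝓝 ρp) :=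
    tendsto_of_tendsto_of_tendsto_of_le_of_le hWlimp tendsto_const_nhds hxy (fun x => hWlt _)
  have hWym : Tendsto (fun x => W (x + ℓ / W x)) atBot (𝓝 ρm) := by
    have h1 : Tendsto (fun x => W (x + ℓ / ρm)) atBot (𝓝 ρm) :=
      hWlimm.comp (tendsto_atBot_add_const_right _ _ tendsto_id)
    refine tendsto_of_tendsto_of_tendsto_of_le_of_le hWlimm h1 hxy (fun x => hWmono ?_)
    have := hWgt x
    gcongr
  obtain ⟨p1, p2, p3, p4⟩ := aux_limits hℓ hρp0 hφρp hφc hφ'c hWlimp hWyp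
    (tendsto_of_tendsto_of_tendsto_of_le_of_le hWlimp hWyp hξ1 hξ2)
  obtain ⟨m1, m2, m3, m4⟩ := aux_limits hℓ hρm0 hφρm hφc hφ'c hWlimm hWym
    (tendsto_of_tendsto_of_tendsto_of_le_of_le hWlimm hWym hξ1 hξ2)
  have P := aux_plus (hkpos ρp hρp0 hρpI hφρp) (show 0 < ℓ / ρp by positivity)
    (by rw [hkd ρp hρp0 hφρp, lt_div_iff₀ hφρp]; linarith) hWp hpd hpos hWmono hp' hc p1 p2 p3 p4
  have N := aux_minus (hkpos ρm hρm0 hmI hφρm) (show 0 < ℓ / ρm by positivity)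
    (by rw [hkd ρm hρm0 hφρm, div_lt_iff₀ hφρm]; linarith) hWp hpd hpos hWmono hp' hc m1 m2 m3 m4
  obtain ⟨X, hX⟩ := eventually_atTop.1 P
  obtain ⟨Y, hY⟩ := eventually_atBot.1 N
  refine ⟨max 1 (max X (-Y)), by positivity, fun x hx => hX x ?_, fun x hx => hY x ?_⟩
  · exact ((le_max_left _ _).trans (le_max_right _ _)).trans hx
  · have : -Y ≤ max 1 (max X (-Y)) := (le_max_right _ _).trans (le_max_right _ _)
    linarith
end

section
/- (Traveling waves with nonzero speed.) Let σ ∈ ℝ, let {z_i(t)} solve the FtL system ż_i = V φ(ℓ/(z_{i+1} − z_i)), and set ζ_i(t) = z_i(t) − V σ t and ρ_i(t) = ℓ/(z_{i+1}(t) − z_i(t)). Then ζ̇_i(t) = V (φ(ρ_i(t)) − σ) and ρ̇_i(t) = (V/ℓ) ρ_i(t)² (φ(ρ_i(t)) − φ(ρ_{i+1}(t))). Moreover, if 𝒲 : ℝ → (0,1) is a differentiable profile, {ζ_i(0)} is generated by 𝒲, and φ(𝒲(ξ)) ≠ σ for all ξ, then 𝒲(ζ_i(t)) = ρ_i(t)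 for all i and all t ≥ 0 if and only if 𝒲 satisfies the delay differential equation 𝒲'(ξ) = (𝒲(ξ)²/(ℓ (φ(𝒲(ξ)) − σ))) · [φ(𝒲(ξ)) − φ(𝒲(ξ + ℓ/𝒲(ξ)))]. -/
open Filter Topology

lemma flow_pos (f : ℝ → ℝ) (C : ℝ) (hf : Continuous f) (hpos : ∀ x, 0 < f x)
    (hC : ∀ x, f x ≤ C) :
    ∃ F G : ℝ → ℝ, StrictMono F ∧ (∀ x, HasDerivAt F (f x)⁻¹ x) ∧ (∀ t, F (G t) = t) ∧
      (∀ t, HasDerivAt G (f (G t)) t) := by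
  have hCpos : 0 < C := lt_of_lt_of_le (hpos 0) (hC 0)
  have hcont : Continuous (fun x => (f x)⁻¹) := hf.inv₀ (fun x => (hpos x).ne')
  set F : ℝ → ℝ := fun x => ∫ u in (0:ℝ)..x, (f u)⁻¹ with hF
  have hd : ∀ x, HasDerivAt F (f x)⁻¹ x := fun x =>
    intervalIntegral.integral_hasDerivAt_right (hcont.intervalIntegrable _ _)
      (hcont.stronglyMeasurableAtFilter _ _) hcont.continuousAt
  have hmono : StrictMono F := strictMono_of_deriv_pos (fun x => by
    rw [(hd x).deriv]; exact inv_pos.mpr (hpos x))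
  have hm2 : Monotone (fun x => F x - x * C⁻¹) := by
    have hd2 : ∀ x, HasDerivAt (fun x => F x - x * C⁻¹) ((f x)⁻¹ - 1 * C⁻¹) x := fun x =>
      (hd x).sub ((hasDerivAt_id x).mul_const _)
    apply monotone_of_deriv_nonneg (fun x => (hd2 x).differentiableAt)
    intro x
    rw [(hd2 x).deriv, one_mul, sub_nonneg]
    exact inv_anti₀ (hpos x) (hC x)
  have hFc : Continuous F := continuous_iff_continuousAt.mpr fun x => (hd x).continuousAt
  have hsurj : Function.Surjective F := by
    apply hFc.surjective
    · have h1 : Tendsto (fun x : ℝ => F 0 + x * C⁻¹) atTop atTop :=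
        tendsto_atTop_add_const_left _ _ (tendsto_id.atTop_mul_const (inv_pos.mpr hCpos))
      refine tendsto_atTop_mono' _ ?_ h1
      filter_upwards [eventually_ge_atTop 0] with x hx
      have := hm2 hx
      simp only [zero_mul, sub_zero] at this
      linarith
    · have h1 : Tendsto (fun x : ℝ => F 0 + x * C⁻¹) atBot atBot :=
        tendsto_atBot_add_const_left _ _ (tendsto_id.atBot_mul_const (inv_pos.mpr hCpos))
      refine tendsto_atBot_mono' _ ?_ h1
      filter_upwards [eventually_le_atBot 0] with x hx
      have := hm2 hx
      simp only [zero_mul, sub_zero] at this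
      linarith
  let e := hmono.orderIsoOfSurjective F hsurj
  have hFG : ∀ t, F (e.symm t) = t := fun t => e.apply_symm_apply t
  refine ⟨F, e.symm, hmono, hd, hFG, fun t => ?_⟩
  have := HasDerivAt.of_local_left_inverse (e.symm.continuous.continuousAt (x := t)) (hd (e.symm t))
    (inv_ne_zero (hpos _).ne') (Eventually.of_forall hFG)
  rwa [inv_inv] at this

lemma flow_ne (f : ℝ → ℝ) (C : ℝ) (hf : Continuous f) (hne : ∀ x, f x ≠ 0)
    (hC : ∀ x, |f x| ≤ C) :
    ∃ F G : ℝ → ℝ, (StrictMono F ∨ StrictAnti F) ∧ (∀ x, HasDerivAt F (f x)⁻¹ x) ∧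
      (∀ t, F (G t) = t) ∧ (∀ t, HasDerivAt G (f (G t)) t) := by
  have hsign : (∀ x, 0 < f x) ∨ (∀ x, f x < 0) := by
    by_contra! h
    obtain ⟨⟨a, ha⟩, b, hb⟩ := h
    obtain ⟨c, hc⟩ := mem_range_of_exists_le_of_exists_ge hf ⟨a, ha⟩ ⟨b, hb⟩
    exact hne c hc
  rcases hsign with h | h
  · obtain ⟨F, G, h1, h2, h3, h4⟩ := flow_pos f C hf h (fun x => (le_abs_self _).trans (hC x))
    exact ⟨F, G, Or.inl h1, h2, h3, h4⟩
  · obtain ⟨F, G, h1, h2, h3, h4⟩ := flow_pos (fun x => - f x) C hf.neg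
      (fun x => neg_pos.mpr (h x)) (fun x => (neg_le_abs _).trans (hC x))
    refine ⟨fun x => - F x, fun t => G (-t), Or.inr ?_, ?_, ?_, ?_⟩
    · intro a b hab; exact neg_lt_neg (h1 hab)
    · intro x
      have := (h2 x).neg
      rwa [inv_neg, neg_neg] at this
    · intro t; simp [h3]
    · intro t
      have := (h4 (-t)).comp t (hasDerivAt_neg t)
      simpa [Function.comp_def] using this

lemma flow_const (f F x : ℝ → ℝ) (hne : ∀ x, f x ≠ 0) (hF : ∀ x, HasDerivAt F (f x)⁻¹ x)
    (hx : ∀ t, 0 ≤ t → HasDerivAt x (f (x t)) t) (t : ℝ) (ht : 0 ≤ t) :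
    F (x t) = t + F (x 0) := by
  have hd : ∀ s, 0 ≤ s → HasDerivAt (fun s => F (x s) - s) 0 s := fun s hs => by
    have := ((hF (x s)).comp s (hx s hs)).sub (hasDerivAt_id s)
    rwa [inv_mul_cancel₀ (hne _), sub_self] at this
  have := constant_of_has_deriv_right_zero (f := fun s => F (x s) - s) (a := 0) (b := t)
    (fun s hs => (hd s hs.1).continuousAt.continuousWithinAt)
    (fun s hs => (hd s hs.1).hasDerivWithinAt) t ⟨ht, le_rfl⟩
  linarith

lemma ftl_compare (ℓ K : ℝ) (hK : 0 < K) (g : ℝ → ℝ)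
    (hgK : ∀ a b, ℓ ≤ a → ℓ ≤ b → g a - g b ≤ K)
    (hgu : ∀ ε > 0, ∃ δ > 0, ∀ a b, ℓ ≤ a → ℓ ≤ b → a < b + δ → g a ≤ g b + ε)
    (z y : ℤ → ℝ → ℝ)
    (hz : ∀ i t, 0 ≤ t → ℓ ≤ z (i + 1) t - z i t) (hy : ∀ i t, 0 ≤ t → ℓ ≤ y (i + 1) t - y i t)
    (hzd : ∀ i t, 0 ≤ t → HasDerivAt (z i) (g (z (i + 1) t - z i t)) t)
    (hyd : ∀ i t, 0 ≤ t → HasDerivAt (y i) (g (y (i + 1) t - y i t)) t)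
    (h0 : ∀ i, z i 0 = y i 0) (i : ℤ) (t : ℝ) (ht : 0 ≤ t) : z i t ≤ y i t := by
  have hDd : ∀ i t, 0 ≤ t → HasDerivAt (fun s => z i s - y i s)
      (g (z (i + 1) t - z i t) - g (y (i + 1) t - y i t)) t :=
    fun i t ht => (hzd i t ht).sub (hyd i t ht)
  have key : ∀ ε > 0, ∀ i t, 0 ≤ t → z i t - y i t ≤ ε * t := by
    intro ε hε
    obtain ⟨δ, hδ, hg⟩ := hgu (ε / 2) (by linarith)
    set h : ℝ := δ / (2 * K) with hh
    have hhpos : 0 < h := by positivity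
    have hKh : K * h < δ := by
      have : K * h = δ / 2 := by rw [hh]; field_simp
      linarith
    have ind : ∀ n : ℕ, ∀ i t, 0 ≤ t → t ≤ n * h → z i t - y i t ≤ ε * t := by
      intro n
      induction n with
      | zero =>
        intro i t h1 h2
        have : t = 0 := le_antisymm (by simpa using h2) h1
        subst this
        simp [h0]
      | succ n ih =>
        intro i t h1 h2
        by_cases hcase : t ≤ n * h
        · exact ih i t h1 hcase
        push Not at hcase
        have hn0 : (0:ℝ) ≤ n * h := by positivity
        have grow : ∀ j s, n * h ≤ s → z j s - y j s ≤ ε * (n * h) + K * (s - n * h) := by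
          intro j s hs
          refine image_le_of_deriv_right_le_deriv_boundary (f := fun s => z j s - y j s)
            (f' := fun t => g (z (j + 1) t - z j t) - g (y (j + 1) t - y j t))
            (a := n * h) (b := s) (B := fun s => ε * (n * h) + K * (s - n * h)) (B' := fun _ => K)
            ?_ ?_ ?_ ?_ ?_ ?_ ⟨hs, le_rfl⟩
          · intro u hu
            exact (hDd j u (hn0.trans hu.1)).continuousAt.continuousWithinAt
          · intro u hu
            exact (hDd j u (hn0.trans hu.1)).hasDerivWithinAt
          · have := ih j (n * h) hn0 le_rfl
            simpa using this
          · fun_prop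
          · intro u hu
            have : HasDerivAt (fun s : ℝ => ε * (n * h) + K * (s - n * h)) (K * 1) u :=
              (((hasDerivAt_id u).sub_const _).const_mul K).const_add _
            rw [mul_one] at this
            exact this.hasDerivWithinAt
          · intro u hu
            exact hgK _ _ (hz _ _ (hn0.trans hu.1)) (hy _ _ (hn0.trans hu.1))
        refine image_le_of_deriv_right_lt_deriv_boundary (f := fun s => z i s - y i s)
            (f' := fun t => g (z (i + 1) t - z i t) - g (y (i + 1) t - y i t))
            (a := n * h) (b := t) (B := fun s => ε * s) (B' := fun _ => ε)
            ?_ ?_ ?_ ?_ ?_ ⟨hcase.le, le_rfl⟩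
        · intro u hu
          exact (hDd i u (hn0.trans hu.1)).continuousAt.continuousWithinAt
        · intro u hu
          exact (hDd i u (hn0.trans hu.1)).hasDerivWithinAt
        · exact ih i (n * h) hn0 le_rfl
        · intro u
          simpa using (hasDerivAt_id u).const_mul ε
        · intro u hu heq
          have hu0 := hn0.trans hu.1
          have h3 := grow (i + 1) u hu.1
          have h4 : K * (u - n * h) ≤ K * h := by
            apply mul_le_mul_of_nonneg_left _ hK.le
            push_cast at h2
            linarith [hu.2]
          have h5 : ε * (n * h) ≤ ε * u := mul_le_mul_of_nonneg_left hu.1 hε.le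
          have := hg (z (i + 1) u - z i u) (y (i + 1) u - y i u) (hz _ _ hu0) (hy _ _ hu0)
            (by linarith)
          linarith
    intro i t ht
    obtain ⟨n, hn⟩ := exists_nat_ge (t / h)
    exact ind n i t ht ((div_le_iff₀ hhpos).mp hn)
  by_contra! hlt
  have hpos : 0 < z i t - y i t := by linarith
  have h1 := key ((z i t - y i t) / (2 * (t + 1))) (by positivity) i t ht
  rw [div_mul_eq_mul_div, le_div_iff₀ (by positivity)] at h1
  nlinarith


/-- Traveling waves with nonzero speed: in the shifted
coordinate `ζ_i(t) = z_i(t) − Vσt`, the FtL system becomes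
`ζ̇_i = V(φ(ρ_i) − σ)`, `ρ̇_i = (V/ℓ)ρ_i²(φ(ρ_i) − φ(ρ_{i+1}))`; and a
differentiable profile `𝒲 : ℝ → (0,1)` with `φ(𝒲) ≠ σ`, generating the
initial shifted positions, is traced by the shifted cars if and only if it
satisfies the DDE
`𝒲'(ξ) = (𝒲²/(ℓ(φ(𝒲) − σ))) [φ(𝒲(ξ)) − φ(𝒲(ξ + ℓ/𝒲(ξ)))]`. -/
theorem traveling_wave_nonzero_speed
    (ℓ V chat σ : ℝ) (hℓ : 0 < ℓ) (hV : 0 < V) (hchat : 0 < chat)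
    (φ : ℝ → ℝ) (hφd : Differentiable ℝ φ)
    (hφ1 : φ 1 = 0) (hφ0 : φ 0 = 1)
    (hφ' : ∀ ρ ∈ Set.Icc (0:ℝ) 1, deriv φ ρ ≤ -chat)
    (z : ℤ → ℝ → ℝ)
    (hspace : ∀ (i : ℤ) (t : ℝ), z i t ≤ z (i + 1) t - ℓ)
    (hode : ∀ (i : ℤ) (t : ℝ),
      HasDerivAt (z i) (V * φ (ℓ / (z (i + 1) t - z i t))) t) :
    (∀ (i : ℤ) (t : ℝ),
      HasDerivAt (fun s => z i s - V * σ * s)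
        (V * (φ (ℓ / (z (i + 1) t - z i t)) - σ)) t) ∧
    (∀ (i : ℤ) (t : ℝ),
      HasDerivAt (fun s => ℓ / (z (i + 1) s - z i s))
        (V / ℓ * (ℓ / (z (i + 1) t - z i t)) ^ 2 *
          (φ (ℓ / (z (i + 1) t - z i t)) - φ (ℓ / (z (i + 2) t - z (i + 1) t)))) t) ∧
    (∀ Wc : ℝ → ℝ, Differentiable ℝ Wc → (∀ ξ, Wc ξ ∈ Set.Ioo (0:ℝ) 1) →
      (∀ i : ℤ, (z (i + 1) 0 - V * σ * 0) - (z i 0 - V * σ * 0) =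
        ℓ / Wc (z i 0 - V * σ * 0)) →
      (∀ ξ, φ (Wc ξ) ≠ σ) →
      ((∀ (i : ℤ) (t : ℝ), 0 ≤ t →
          Wc (z i t - V * σ * t) = ℓ / (z (i + 1) t - z i t)) ↔
        (∀ ξ, deriv Wc ξ =
          Wc ξ ^ 2 / (ℓ * (φ (Wc ξ) - σ)) *
            (φ (Wc ξ) - φ (Wc (ξ + ℓ / Wc ξ)))))) := by
  have hgap : ∀ i t, ℓ ≤ z (i + 1) t - z i t := fun i t => by linarith [hspace i t]
  have hA : ∀ (i : ℤ) (t : ℝ), HasDerivAt (fun s => z i s - V * σ * s)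
        (V * (φ (ℓ / (z (i + 1) t - z i t)) - σ)) t := by
    intro i t
    have := (hode i t).sub ((hasDerivAt_id t).const_mul (V * σ))
    refine HasDerivAt.congr_deriv this ?_
    ring
  have hB : ∀ (i : ℤ) (t : ℝ),
      HasDerivAt (fun s => ℓ / (z (i + 1) s - z i s))
        (V / ℓ * (ℓ / (z (i + 1) t - z i t)) ^ 2 *
          (φ (ℓ / (z (i + 1) t - z i t)) - φ (ℓ / (z (i + 2) t - z (i + 1) t)))) t := by
    intro i t
    have hne : z (i + 1) t - z i t ≠ 0 := by linarith [hgap i t]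
    have h1 := hode (i + 1) t
    rw [show i + 1 + 1 = i + 2 by ring] at h1
    have := (hasDerivAt_const t ℓ).div (h1.sub (hode i t)) hne
    refine HasDerivAt.congr_deriv this ?_
    simp only [Pi.sub_apply]
    field_simp
    ring
  refine ⟨hA, hB, ?_⟩
  intro W hWd hW hgen hne
  have hanti : AntitoneOn φ (Set.Icc 0 1) := by
    apply antitoneOn_of_deriv_nonpos (convex_Icc 0 1) hφd.continuous.continuousOn
      hφd.differentiableOn
    intro x hx
    have := hφ' x (interior_subset hx)
    linarith
  have hφb : ∀ x ∈ Set.Icc (0:ℝ) 1, 0 ≤ φ x ∧ φ x ≤ 1 := by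
    intro x hx
    constructor
    · rw [← hφ1]; exact hanti hx ⟨zero_le_one, le_rfl⟩ hx.2
    · rw [← hφ0]; exact hanti ⟨le_rfl, zero_le_one⟩ hx hx.1
  have hWI : ∀ ξ, W ξ ∈ Set.Icc (0:ℝ) 1 := fun ξ => ⟨(hW ξ).1.le, (hW ξ).2.le⟩
  set f : ℝ → ℝ := fun x => V * (φ (W x) - σ) with hf
  have hfc : Continuous f :=
    continuous_const.mul ((hφd.continuous.comp hWd.continuous).sub continuous_const)
  have hfne : ∀ x, f x ≠ 0 := fun x => mul_ne_zero hV.ne' (sub_ne_zero.mpr (hne x))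
  have hfC : ∀ x, |f x| ≤ V * (1 + |σ|) := by
    intro x
    rw [hf]; simp only
    rw [abs_mul, abs_of_pos hV]
    apply mul_le_mul_of_nonneg_left _ hV.le
    refine (abs_sub _ _).trans ?_
    have := hφb _ (hWI x)
    rw [abs_of_nonneg this.1]
    linarith
  obtain ⟨F, G, hFm, hFd, hFG, hGd⟩ := flow_ne f _ hfc hfne hfC
  have hFinj : Function.Injective F := hFm.elim StrictMono.injective StrictAnti.injective
  constructor
  · intro htr ξ
    have hup : ∀ n : ℕ, z 0 0 + n * ℓ ≤ z n 0 := by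
      intro n
      induction n with
      | zero => simp
      | succ n ih => push_cast; linarith [hspace n 0]
    have hdn : ∀ n : ℕ, z (-n) 0 ≤ z 0 0 - n * ℓ := by
      intro n
      induction n with
      | zero => simp
      | succ n ih =>
        have := hspace (-((n:ℤ) + 1)) 0
        rw [show -((n:ℤ) + 1) + 1 = -n by ring] at this
        push_cast; linarith
    have hex : ∃ i, F (z i 0) < F ξ := by
      rcases hFm with hm | hm
      · obtain ⟨n, hn⟩ := exists_nat_gt ((z 0 0 - ξ) / ℓ)
        rw [div_lt_iff₀ hℓ] at hn
        exact ⟨-n, hm (by linarith [hdn n])⟩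
      · obtain ⟨n, hn⟩ := exists_nat_gt ((ξ - z 0 0) / ℓ)
        rw [div_lt_iff₀ hℓ] at hn
        exact ⟨n, hm (by linarith [hup n])⟩
    obtain ⟨i, hi⟩ := hex
    have hfl := flow_const f F (fun s => z i s - V * σ * s) hfne hFd (fun t ht => by
      have := hA i t
      rw [← htr i t ht] at this
      exact this) (F ξ - F (z i 0)) (by linarith)
    simp only [mul_zero, sub_zero, sub_add_cancel] at hfl
    set t := F ξ - F (z i 0) with ht
    have htpos : 0 < t := by rw [ht]; linarith
    have hξ := hFinj hfl
    have e1 := htr i t htpos.le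
    have e2 := htr (i + 1) t htpos.le
    rw [show i + 1 + 1 = i + 2 by ring] at e2
    have hd1 : HasDerivAt (fun s => W (z i s - V * σ * s)) _ t :=
      ((hWd (z i t - V * σ * t)).hasDerivAt).comp t (hA i t)
    have hd2 := hB i t
    have hev : (fun s => ℓ / (z (i + 1) s - z i s)) =ᶠ[𝓝 t]
        (fun s => W (z i s - V * σ * s)) := by
      filter_upwards [lt_mem_nhds htpos] with s hs
      exact (htr i s hs.le).symm
    have heq := hd1.unique (hd2.congr_of_eventuallyEq hev.symm)
    have hnext : z (i + 1) t - V * σ * t = ξ + ℓ / W ξ := by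
      rw [hξ] at e1
      rw [e1, ← hξ, div_div_eq_mul_div, mul_div_cancel_left₀ _ hℓ.ne']
      ring
    rw [← e1, ← e2, hnext, hξ] at heq
    have hs : φ (W ξ) - σ ≠ 0 := sub_ne_zero.mpr (hne ξ)
    field_simp
    field_simp at heq
    linarith
  · intro hdde
    set y : ℤ → ℝ → ℝ := fun i t => G (t + F (z i 0)) with hy
    have hGF : ∀ x, G (F x) = x := fun x => hFinj (hFG _)
    have hyd : ∀ i t, HasDerivAt (y i) (f (y i t)) t := by
      intro i t
      exact HasDerivAt.comp_add_const t (F (z i 0)) (hGd _)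
    have hy0 : ∀ i, y i 0 = z i 0 := by
      intro i; simp [hy, hGF]
    have hynext : ∀ i t, 0 ≤ t → y (i + 1) t = y i t + ℓ / W (y i t) := by
      intro i t ht
      have hx : ∀ t, HasDerivAt (fun s => y i s + ℓ / W (y i s))
          (f (y i t + ℓ / W (y i t))) t := by
        intro t
        have hWne : W (y i t) ≠ 0 := (hW _).1.ne'
        have hWy : HasDerivAt (fun s => W (y i s)) _ t :=
          ((hWd (y i t)).hasDerivAt).comp t (hyd i t)
        have := (hyd i t).add ((hasDerivAt_const t ℓ).div hWy hWne)
        refine HasDerivAt.congr_deriv this ?_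
        rw [hdde]
        have hs : φ (W (y i t)) - σ ≠ 0 := sub_ne_zero.mpr (hne _)
        simp only [hf]
        field_simp
        ring
      have := flow_const f F _ hfne hFd (fun t _ => hx t) t ht
      apply hFinj
      rw [this]
      simp only [hy, hFG, zero_add, hGF]
      have h2 := hgen i
      simp only [mul_zero, sub_zero] at h2
      rw [← h2]; congr 2; ring
    have hygap : ∀ i t, 0 ≤ t →
        (y (i + 1) t + V * σ * t) - (y i t + V * σ * t) = ℓ / W (y i t) := by
      intro i t ht
      rw [hynext i t ht]; ring
    have hygap' : ∀ i t, 0 ≤ t →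
        ℓ ≤ (y (i + 1) t + V * σ * t) - (y i t + V * σ * t) := by
      intro i t ht
      rw [hygap i t ht, le_div_iff₀ (hW _).1]
      nlinarith [(hW (y i t)).2]
    set g : ℝ → ℝ := fun d => V * φ (ℓ / d) with hg
    have hyd' : ∀ i t, 0 ≤ t → HasDerivAt (fun s => y i s + V * σ * s)
        (g ((y (i + 1) t + V * σ * t) - (y i t + V * σ * t))) t := by
      intro i t ht
      have := (hyd i t).add ((hasDerivAt_id t).const_mul (V * σ))
      refine HasDerivAt.congr_deriv this ?_
      rw [hygap i t ht]
      simp only [hg, hf]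
      rw [div_div_eq_mul_div, mul_div_cancel_left₀ _ hℓ.ne']
      ring
    have hr : ∀ d, ℓ ≤ d → ℓ / d ∈ Set.Icc (0:ℝ) 1 := by
      intro d hd
      have : 0 < d := by linarith
      exact ⟨by positivity, (div_le_one this).mpr hd⟩
    have hgK : ∀ a b, ℓ ≤ a → ℓ ≤ b → g a - g b ≤ V := by
      intro a b ha hb
      have h1 := hφb _ (hr a ha)
      have h2 := hφb _ (hr b hb)
      simp only [hg]
      nlinarith
    have hgu : ∀ ε > 0, ∃ δ > 0, ∀ a b, ℓ ≤ a → ℓ ≤ b → a < b + δ → g a ≤ g b + ε := by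
      intro ε hε
      have huc := isCompact_Icc.uniformContinuousOn_of_continuous
        (hφd.continuous.continuousOn (s := Set.Icc (0:ℝ) 1))
      rw [Metric.uniformContinuousOn_iff] at huc
      obtain ⟨δ, hδ, H⟩ := huc (ε / V) (by positivity)
      refine ⟨δ * ℓ, by positivity, ?_⟩
      intro a b ha hb hab
      have ha0 : 0 < a := by linarith
      have hb0 : 0 < b := by linarith
      rcases le_total a b with h | h
      · have : φ (ℓ / a) ≤ φ (ℓ / b) :=
          hanti (hr b hb) (hr a ha) (div_le_div_of_nonneg_left hℓ.le ha0 h)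
        have := mul_le_mul_of_nonneg_left this hV.le
        simp only [hg]; linarith
      · have hle : ℓ / a ≤ ℓ / b := div_le_div_of_nonneg_left hℓ.le hb0 h
        have hd : dist (ℓ / a) (ℓ / b) < δ := by
          rw [Real.dist_eq, abs_sub_comm, abs_of_nonneg (by linarith), div_sub_div _ _ hb0.ne' ha0.ne',
            div_lt_iff₀ (by positivity)]
          have h1 : ℓ * (a - b) < ℓ * (δ * ℓ) := mul_lt_mul_of_pos_left (by linarith) hℓ
          have h2 : ℓ * ℓ ≤ b * a := mul_le_mul hb ha hℓ.le hb0.le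
          have h3 := mul_le_mul_of_nonneg_left h2 hδ.le
          linarith
        have h1 := H _ (hr a ha) _ (hr b hb) hd
        rw [Real.dist_eq] at h1
        have h2 := (le_abs_self _).trans_lt h1
        rw [lt_div_iff₀ hV] at h2
        simp only [hg]; linarith
    have h0 : ∀ i, z i 0 = y i 0 + V * σ * 0 := by intro i; rw [hy0]; ring
    intro i t ht
    have le1 := ftl_compare ℓ V hV g hgK hgu z (fun i s => y i s + V * σ * s)
      (fun i t _ => hgap i t) hygap' (fun i t _ => hode i t) hyd' h0
    have le2 := ftl_compare ℓ V hV g hgK hgu (fun i s => y i s + V * σ * s) z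
      hygap' (fun i t _ => hgap i t) hyd' (fun i t _ => hode i t) (fun i => (h0 i).symm)
    have heq : ∀ i, z i t = y i t + V * σ * t := fun i => le_antisymm (le1 i t ht) (le2 i t ht)
    rw [heq i, heq (i + 1), hygap i t ht, add_sub_cancel_right, div_div_eq_mul_div,
      mul_div_cancel_left₀ _ hℓ.ne']
end
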